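/- arXiv:1905.06062 — 2 statements merged into one kernel-verified Lean document; each statement's English description precedes it below -/
import Mathlib

section
/- Under the hypotheses of the previous direct-limit lemma, if in addition each j_{m,n} is amenable, then each direct limit map j_{n,ω} : M_n → M_ω is amenable, and consequently M_ω = ⋃_{n<ω} M_n. -/
open FirstOrder FirstOrder.Language

/-- The language of set theory: one binary relation symbol. -/
def ZFLang : FirstOrder.Language :=
  ⟨fun _ => Empty, fun n => match n with | 2 => Unit | _ => Empty⟩

def memRel : ZFLang.Relations 2 := ()

/-- The membership structure on a class of ZF-sets. -/
noncomputable instance zfStr (M : Set ZFSet) : ZFLang.Structure ↥M where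
  funMap {n} f _ := f.elim
  RelMap {n} r v :=
    match n, r, v with
    | 2, _, v => ((v 0 : ↥M) : ZFSet) ∈ ((v 1 : ↥M) : ZFSet)
    | 0, r, _ => r.elim
    | 1, r, _ => r.elim
    | (_+3), r, _ => r.elim

/-- The formula `x ∈ y`. -/
def mem' {n : ℕ} (x y : Fin n) : ZFLang.BoundedFormula Empty n :=
  Relations.boundedFormula₂ memRel (Term.var (Sum.inr x)) (Term.var (Sum.inr y))

/-- The formula `x = y`. -/
def eq' {n : ℕ} (x y : Fin n) : ZFLang.BoundedFormula Empty n :=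
  Term.bdEqual (Term.var (Sum.inr x)) (Term.var (Sum.inr y))

def extAx : ZFLang.Sentence :=
  ∀' ∀' ((∀' (mem' 2 0 ⇔ mem' 2 1)) ⟹ eq' 0 1)

def pairAx : ZFLang.Sentence :=
  ∀' ∀' ∃' ∀' (mem' 3 2 ⇔ (eq' 3 0 ⊔ eq' 3 1))

def unionAx : ZFLang.Sentence :=
  ∀' ∃' ∀' (mem' 2 1 ⇔ ∃' (mem' 3 0 ⊓ mem' 2 3))

def powerAx : ZFLang.Sentence :=
  ∀' ∃' ∀' (mem' 2 1 ⇔ ∀' (mem' 3 2 ⟹ mem' 3 0))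

def infAx : ZFLang.Sentence :=
  ∃' ((∃' (mem' 1 0 ⊓ ∀' (∼(mem' 2 1)))) ⊓
    (∀' (mem' 1 0 ⟹ ∃' (mem' 2 0 ⊓ ∀' (mem' 3 2 ⇔ (mem' 3 1 ⊔ eq' 3 1))))))

def foundAx : ZFLang.Sentence :=
  ∀' ((∃' (mem' 1 0)) ⟹ ∃' (mem' 1 0 ⊓ ∀' (mem' 2 1 ⟹ ∼(mem' 2 0))))

/-- The separation axiom for a formula with `k` parameters. -/
def sepAx {k : ℕ} (φ : ZFLang.BoundedFormula Empty (k + 1)) : ZFLang.Sentence :=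
  (mem' ⟨k+2, by omega⟩ ⟨k+1, by omega⟩ ⇔
      (mem' ⟨k+2, by omega⟩ ⟨k, by omega⟩ ⊓ φ.liftAt 2 k)).all.ex.all.alls

/-- The collection axiom for a formula with `k` parameters. -/
def collAx {k : ℕ} (φ : ZFLang.BoundedFormula Empty (k + 2)) : ZFLang.Sentence :=
  (mem' ⟨k+2, by omega⟩ ⟨k, by omega⟩ ⟹
      ((φ.liftAt 2 k).ex ⟹
        ((mem' ⟨k+3, by omega⟩ ⟨k+1, by omega⟩ ⊓ φ.liftAt 2 k).ex))).all.ex.all.alls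

def choiceAx : ZFLang.Sentence :=
  (((∀' ((mem' 1 0) ⟹ (∃' (mem' 2 1)))) ⊓
    (∀' ∀' ((((mem' 1 0) ⊓ (mem' 2 0)) ⊓ (∼(eq' 1 2))) ⟹ (∀' (∼((mem' 3 1) ⊓ (mem' 3 2)))))))
   ⟹
   (∃' ∀' ((mem' 2 0) ⟹
      (∃' (((mem' 3 2) ⊓ (mem' 3 1)) ⊓
        (∀' (((mem' 4 2) ⊓ (mem' 4 1)) ⟹ (eq' 4 3)))))))).all

/-- The ZFC axioms: extensionality, pairing, union, powerset, infinity, foundation, choice,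
separation, and collection. -/
def ZFCTheory : ZFLang.Theory :=
  {extAx, pairAx, unionAx, powerAx, infAx, foundAx, choiceAx} ∪
    (⋃ (k : ℕ), Set.range (@sepAx k)) ∪ (⋃ (k : ℕ), Set.range (@collAx k))

/-- A class of ZF-sets is transitive. -/
def SetTransitive (M : Set ZFSet) : Prop := ∀ x ∈ M, ∀ y : ZFSet, y ∈ x → y ∈ M

/-- A transitive model of ZFC. -/
def IsZFCModel (M : Set ZFSet) : Prop := SetTransitive M ∧ ZFCTheory.Model ↥M

/-- Two classes have the same ordinals. -/
def SameOrdinals (M N : Set ZFSet) : Prop :=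
  ∀ x : ZFSet, x.IsOrdinal → (x ∈ M ↔ x ∈ N)

/-- `z` is the pointwise image `j[x]` of `x` under `j`. -/
def ImageSet (M N : Set ZFSet) (j : ↥M → ↥N) (x z : ZFSet) : Prop :=
  ∀ w : ZFSet, w ∈ z ↔ ∃ y : ↥M, (y : ZFSet) ∈ x ∧ ((j y : ↥N) : ZFSet) = w

/-- `j : M → N` is amenable: every pointwise image `j[x]`, `x ∈ M`, belongs to `N`. -/
def Amenable (M N : Set ZFSet) (j : ↥M → ↥N) : Prop :=
  ∀ x ∈ M, ∃ z ∈ N, ImageSet M N j x z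

/-- `κ` is the critical point of `j`: the least ordinal moved. -/
def IsCrit (M N : Set ZFSet) (j : ↥M → ↥N) (κ : ZFSet) : Prop :=
  κ.IsOrdinal ∧ ∃ h : κ ∈ M, ((j ⟨κ, h⟩ : ↥N) : ZFSet) ≠ κ ∧
    ∀ β : ZFSet, β ∈ κ → ∀ hb : β ∈ M, ((j ⟨β, hb⟩ : ↥N) : ZFSet) = β

/-- `f` is a cofinal map from `β` into the ordinal `α`. -/
def CofinalIn (β α f : ZFSet) : Prop :=
  ∀ γ, γ ∈ α → ∃ ξ, ξ ∈ β ∧ ∃ η, ξ.pair η ∈ f ∧ (γ ∈ η ∨ γ = η)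

/-- `α` is a regular ordinal from the point of view of the class `M`. -/
def RegularIn (M : Set ZFSet) (α : ZFSet) : Prop :=
  ∀ β, β ∈ α → ∀ f, f ∈ M → ZFSet.IsFunc β α f → ¬ CofinalIn β α f

/-! ### Predicates defined by one formula in two structures -/

section Definability

universe u

variable {M N : Set ZFSet.{u}} {C ι : Type*}

/-- `P` and `Q` are defined, in `M` and in `N` respectively, by one and the same formula of set
theory, whose parameters are interpreted by `c` in `M` and by `c'` in `N`. -/
class CoDef (c : C → ↥M) (c' : C → ↥N) (P : (ι → ↥M) → Prop) (Q : (ι → ↥N) → Prop) : Prop where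
  exists_formula : ∃ φ : ZFLang.Formula (C ⊕ ι),
    (∀ v, φ.Realize (Sum.elim c v) ↔ P v) ∧ ∀ v, φ.Realize (Sum.elim c' v) ↔ Q v

/-- `s` and `t` are the interpretations, in `M` and in `N` respectively, of one and the same
variable or parameter. -/
class CoTerm (c : C → ↥M) (c' : C → ↥N) (s : (ι → ↥M) → ↥M) (t : (ι → ↥N) → ↥N) : Prop where
  exists_var : ∃ a : C ⊕ ι, (∀ v, Sum.elim c v a = s v) ∧ ∀ v, Sum.elim c' v a = t v

/-- `P` is definable in `M` with parameters. -/
abbrev ParamDef (P : (ι → ↥M) → Prop) : Prop := CoDef (id : ↥M → ↥M) id P P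

instance CoTerm.var (c : C → ↥M) (c' : C → ↥N) (i : ι) :
    CoTerm c c' (fun v => v i) (fun v => v i) :=
  ⟨Sum.inr i, fun _ => rfl, fun _ => rfl⟩

instance CoTerm.param (x : ↥M) :
    CoTerm (id : ↥M → ↥M) id (fun _ : ι → ↥M => x) (fun _ => x) :=
  ⟨Sum.inl x, fun _ => rfl, fun _ => rfl⟩

theorem relMap_memRel (v : Fin 2 → ↥M) :
    Structure.RelMap memRel v ↔ (v 0 : ZFSet) ∈ (v 1 : ZFSet) := Iff.rfl

namespace CoDef

variable {c : C → ↥M} {c' : C → ↥N}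

instance mem (s t : (ι → ↥M) → ↥M) (s' t' : (ι → ↥N) → ↥N) [hs : CoTerm c c' s s']
    [ht : CoTerm c c' t t'] :
    CoDef c c' (fun v => (s v : ZFSet) ∈ (t v : ZFSet))
      (fun v => (s' v : ZFSet) ∈ (t' v : ZFSet)) := by
  obtain ⟨a, ha, ha'⟩ := hs
  obtain ⟨b, hb, hb'⟩ := ht
  refine ⟨memRel.formula₂ (Term.var a) (Term.var b), fun v => ?_, fun v => ?_⟩ <;>
  simp [Formula.realize_rel₂, relMap_memRel, *]

instance eq (s t : (ι → ↥M) → ↥M) (s' t' : (ι → ↥N) → ↥N) [hs : CoTerm c c' s s']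
    [ht : CoTerm c c' t t'] :
    CoDef c c' (fun v => s v = t v) (fun v => s' v = t' v) := by
  obtain ⟨a, ha, ha'⟩ := hs
  obtain ⟨b, hb, hb'⟩ := ht
  refine ⟨(Term.var a).equal (Term.var b), fun v => ?_, fun v => ?_⟩ <;> simp [*]

variable (P P₁ : (ι → ↥M) → Prop) (Q Q₁ : (ι → ↥N) → Prop)

instance not [h : CoDef c c' P Q] : CoDef c c' (fun v => ¬P v) (fun v => ¬Q v) := by
  obtain ⟨φ, h, h'⟩ := h
  refine ⟨∼φ, fun v => ?_, fun v => ?_⟩ <;> simp [*]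

instance imp [h : CoDef c c' P Q] [h₁ : CoDef c c' P₁ Q₁] :
    CoDef c c' (fun v => P v → P₁ v) (fun v => Q v → Q₁ v) := by
  obtain ⟨φ, h, h'⟩ := h
  obtain ⟨ψ, h₁, h₁'⟩ := h₁
  refine ⟨φ.imp ψ, fun v => ?_, fun v => ?_⟩ <;> simp [*]

instance and [h : CoDef c c' P Q] [h₁ : CoDef c c' P₁ Q₁] :
    CoDef c c' (fun v => P v ∧ P₁ v) (fun v => Q v ∧ Q₁ v) := by
  obtain ⟨φ, h, h'⟩ := h
  obtain ⟨ψ, h₁, h₁'⟩ := h₁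
  refine ⟨φ ⊓ ψ, fun v => ?_, fun v => ?_⟩ <;> simp [*]

instance or [h : CoDef c c' P Q] [h₁ : CoDef c c' P₁ Q₁] :
    CoDef c c' (fun v => P v ∨ P₁ v) (fun v => Q v ∨ Q₁ v) := by
  obtain ⟨φ, h, h'⟩ := h
  obtain ⟨ψ, h₁, h₁'⟩ := h₁
  refine ⟨φ ⊔ ψ, fun v => ?_, fun v => ?_⟩ <;> simp [*]

instance iff [h : CoDef c c' P Q] [h₁ : CoDef c c' P₁ Q₁] :
    CoDef c c' (fun v => P v ↔ P₁ v) (fun v => Q v ↔ Q₁ v) := by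
  obtain ⟨φ, h, h'⟩ := h
  obtain ⟨ψ, h₁, h₁'⟩ := h₁
  refine ⟨φ.iff ψ, fun v => ?_, fun v => ?_⟩ <;> simp [*]

instance ex (P : (ι → ↥M) → ↥M → Prop) (Q : (ι → ↥N) → ↥N → Prop)
    [h : CoDef c c' (fun v : Option ι → ↥M => P (fun i => v (some i)) (v none))
      (fun v : Option ι → ↥N => Q (fun i => v (some i)) (v none))] :
    CoDef c c' (fun v => ∃ a, P v a) (fun v => ∃ a, Q v a) := by
  obtain ⟨φ, h, h'⟩ := h
  let g : C ⊕ Option ι → (C ⊕ ι) ⊕ Unit :=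
    Sum.elim (fun x => Sum.inl (Sum.inl x))
      (fun o => o.elim (Sum.inr ()) fun i => Sum.inl (Sum.inr i))
  refine ⟨(φ.relabel g).iExs Unit, fun v => ?_, fun v => ?_⟩
  · rw [Formula.realize_iExs, ← (Equiv.funUnique Unit ↥M).symm.exists_congr_right]
    refine exists_congr fun a => ?_
    refine Formula.realize_relabel.trans (Iff.trans ?_ (h fun o => o.elim a v))
    refine Eq.to_iff (congrArg φ.Realize (funext ?_))
    rintro (x | (_ | i)) <;> rfl
  · rw [Formula.realize_iExs, ← (Equiv.funUnique Unit ↥N).symm.exists_congr_right]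
    refine exists_congr fun a => ?_
    refine Formula.realize_relabel.trans (Iff.trans ?_ (h' fun o => o.elim a v))
    refine Eq.to_iff (congrArg φ.Realize (funext ?_))
    rintro (x | (_ | i)) <;> rfl

instance all (P : (ι → ↥M) → ↥M → Prop) (Q : (ι → ↥N) → ↥N → Prop)
    [h : CoDef c c' (fun v : Option ι → ↥M => P (fun i => v (some i)) (v none))
      (fun v : Option ι → ↥N => Q (fun i => v (some i)) (v none))] :
    CoDef c c' (fun v => ∀ a, P v a) (fun v => ∀ a, Q v a) := by
  have := CoDef.not (c := c) (c' := c') _ _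
    (h := CoDef.ex (fun v a => ¬P v a) (fun v a => ¬Q v a))
  simpa using this

theorem subst {κ : Type*} {P : (ι → ↥M) → Prop} {Q : (ι → ↥N) → Prop} (h : CoDef c c' P Q)
    (s : ι → (κ → ↥M) → ↥M) (s' : ι → (κ → ↥N) → ↥N) (hs : ∀ i, CoTerm c c' (s i) (s' i)) :
    CoDef c c' (fun v => P fun i => s i v) (fun v => Q fun i => s' i v) := by
  obtain ⟨φ, h, h'⟩ := h
  choose a ha ha' using fun i => (hs i).exists_var
  refine ⟨φ.relabel (Sum.elim Sum.inl a), fun v => ?_, fun v => ?_⟩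
  · rw [Formula.realize_relabel, ← h]
    refine Eq.to_iff (congrArg φ.Realize (funext ?_))
    rintro (x | i)
    · rfl
    · exact ha i v
  · rw [Formula.realize_relabel, ← h']
    refine Eq.to_iff (congrArg φ.Realize (funext ?_))
    rintro (x | i)
    · rfl
    · exact ha' i v

theorem subst₂ {P : ↥M → ↥M → Prop} {Q : ↥N → ↥N → Prop}
    (h : CoDef c c' (fun v : Fin 2 → ↥M => P (v 0) (v 1)) (fun v => Q (v 0) (v 1)))
    (s t : (ι → ↥M) → ↥M) (s' t' : (ι → ↥N) → ↥N) [hs : CoTerm c c' s s']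
    [ht : CoTerm c c' t t'] :
    CoDef c c' (fun v => P (s v) (t v)) (fun v => Q (s' v) (t' v)) :=
  h.subst ![s, t] ![s', t'] (by simp [Fin.forall_fin_two, hs, ht])

theorem subst₃ {P : ↥M → ↥M → ↥M → Prop} {Q : ↥N → ↥N → ↥N → Prop}
    (h : CoDef c c' (fun v : Fin 3 → ↥M => P (v 0) (v 1) (v 2)) (fun v => Q (v 0) (v 1) (v 2)))
    (s t r : (ι → ↥M) → ↥M) (s' t' r' : (ι → ↥N) → ↥N) [hs : CoTerm c c' s s']
    [ht : CoTerm c c' t t'] [hr : CoTerm c c' r r'] :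
    CoDef c c' (fun v => P (s v) (t v) (r v)) (fun v => Q (s' v) (t' v) (r' v)) :=
  h.subst ![s, t, r] ![s', t', r'] (by simp [Fin.forall_fin_succ, hs, ht, hr])

/-- Elementary embeddings preserve predicates defined by a common parameter-free formula. -/
theorem iff_map (j : ↥M ↪ₑ[ZFLang] ↥N) {P : (ι → ↥M) → Prop} {Q : (ι → ↥N) → Prop}
    (h : CoDef (Empty.elim : Empty → ↥M) (Empty.elim : Empty → ↥N) P Q) (v : ι → ↥M) :
    P v ↔ Q (fun i => j (v i)) := by
  obtain ⟨φ, h, h'⟩ := h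
  rw [← h, ← h', ← j.map_formula]
  refine Eq.to_iff (congrArg φ.Realize (funext ?_))
  rintro (x | i)
  · exact x.elim
  · rfl

end CoDef

theorem ParamDef.exists_boundedFormula {m : ℕ} {P : (Fin m → ↥M) → Prop} (h : ParamDef P)
    (b : ↥M) :
    ∃ (k : ℕ) (p : Fin k → ↥M) (φ : ZFLang.BoundedFormula Empty (k + m)),
      ∀ w, φ.Realize default (Fin.append p w) ↔ P w := by
  classical
  obtain ⟨φ, h, -⟩ := h
  let e := φ.freeVarFinset.equivFin
  let f : φ.freeVarFinset → Fin (φ.freeVarFinset.card + m) := fun a =>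
    Sum.elim (fun _ => Fin.castAdd m (e a)) (fun i => Fin.natAdd _ i) a.1
  refine ⟨φ.freeVarFinset.card, fun i => Sum.elim id (fun _ => b) (e.symm i).1,
    BoundedFormula.relabel (Sum.inr : Fin (φ.freeVarFinset.card + m) → Empty ⊕ Fin _)
      (BoundedFormula.restrictFreeVar φ f), fun w => ?_⟩
  refine (Formula.realize_relabel_sumInr _).trans ?_
  rw [← h w]
  refine BoundedFormula.realize_restrictFreeVar _ ?_
  rintro ⟨x | i, hx⟩ <;> simp [f]

@[simp]
theorem realize_mem' {n : ℕ} (a b : Fin n) (v : Empty → ↥M) (xs : Fin n → ↥M) :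
    (mem' a b).Realize v xs ↔ (xs a : ZFSet) ∈ (xs b : ZFSet) := by
  simp [mem', BoundedFormula.realize_rel₂, relMap_memRel]

@[simp]
theorem realize_eq' {n : ℕ} (a b : Fin n) (v : Empty → ↥M) (xs : Fin n → ↥M) :
    (eq' a b).Realize v xs ↔ xs a = xs b := by
  simp [eq']

end Definability

/-! ### Closure properties of transitive models -/

section Model

namespace TransitiveModel

universe u

variable {M : Set ZFSet.{u}} [hM : Fact (IsZFCModel M)]

/-- The separation axiom in a model. -/
theorem separation (P : ↥M → Prop) [h : ParamDef fun v : Fin 1 → ↥M => P (v 0)] (x : ↥M) :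
    ∃ z : ↥M, ∀ w : ↥M, (w : ZFSet) ∈ (z : ZFSet) ↔ (w : ZFSet) ∈ (x : ZFSet) ∧ P w := by
  obtain ⟨k, p, φ, hφ⟩ := ParamDef.exists_boundedFormula h x
  have := hM.out.2.realize_of_mem (sepAx φ)
    (Or.inl (Or.inr (Set.mem_iUnion.2 ⟨k, φ, rfl⟩)))
  rw [sepAx, Sentence.Realize, BoundedFormula.realize_alls] at this
  obtain ⟨z, hz⟩ := BoundedFormula.realize_ex.1 (this p x)
  refine ⟨z, fun w => ?_⟩
  have := hz w
  rw [BoundedFormula.realize_iff, BoundedFormula.realize_inf,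
    BoundedFormula.realize_liftAt (by omega), show Fin.snoc (Fin.snoc (Fin.snoc p x) z) w ∘
      (fun i : Fin (k + 1) => if ↑i < k then Fin.castAdd 2 i else i.addNat 2) =
      Fin.append p fun _ => w from ?_, hφ fun _ => w] at this
  · simpa [Fin.snoc] using this
  · funext i
    refine Fin.addCases (fun i => ?_) (fun i => ?_) i
    · simp [Fin.snoc, (show (i : ℕ) < k + 1 by omega), (show (i : ℕ) < k + 1 + 1 by omega)]
      rfl
    · simp [Fin.snoc]

/-- The collection axiom in a model. -/
theorem collection (P : ↥M → ↥M → Prop)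
    [h : ParamDef fun v : Fin 2 → ↥M => P (v 0) (v 1)] (x : ↥M) :
    ∃ z : ↥M, ∀ w : ↥M, (w : ZFSet) ∈ (x : ZFSet) → (∃ a, P w a) →
      ∃ a : ↥M, (a : ZFSet) ∈ (z : ZFSet) ∧ P w a := by
  obtain ⟨k, p, φ, hφ⟩ := ParamDef.exists_boundedFormula h x
  have := hM.out.2.realize_of_mem (collAx φ) (Or.inr (Set.mem_iUnion.2 ⟨k, φ, rfl⟩))
  rw [collAx, Sentence.Realize, BoundedFormula.realize_alls] at this
  obtain ⟨z, hz⟩ := BoundedFormula.realize_ex.1 (this p x)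
  refine ⟨z, fun w hw => ?_⟩
  have key : ∀ a, (BoundedFormula.liftAt 2 k φ).Realize default
      (Fin.snoc (Fin.snoc (Fin.snoc (Fin.snoc p x) z) w) a) ↔ P w a := by
    intro a
    rw [BoundedFormula.realize_liftAt (by omega),
      show Fin.snoc (Fin.snoc (Fin.snoc (Fin.snoc p x) z) w) a ∘
        (fun i : Fin (k + 2) => if ↑i < k then Fin.castAdd 2 i else i.addNat 2) =
        Fin.append p ![w, a] from ?_, hφ (![w, a])]
    · rfl
    · funext i
      refine Fin.addCases (fun i => ?_) (fun i => ?_) i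
      · simp [Fin.snoc, (show (i : ℕ) < k + 1 by omega), (show (i : ℕ) < k + 1 + 1 by omega),
          (show (i : ℕ) < k + 1 + 1 + 1 by omega)]
        rfl
      · fin_cases i <;> simp [Fin.snoc]
  have := hz w
  simp only [BoundedFormula.realize_imp, BoundedFormula.realize_ex, BoundedFormula.realize_inf,
    key] at this
  simpa [Fin.snoc] using this (by simpa [Fin.snoc] using hw)

theorem realize_axiom {ψ : ZFLang.Sentence}
    (h : ψ ∈ ({extAx, pairAx, unionAx, powerAx, infAx, foundAx, choiceAx} : ZFLang.Theory)) :
    BoundedFormula.Realize ψ (default : Empty → ↥M) default :=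
  hM.out.2.realize_of_mem ψ (Or.inl (Or.inl h))

theorem ext_of_transitive {a b : ↥M}
    (h : ∀ w : ↥M, (w : ZFSet) ∈ (a : ZFSet) ↔ (w : ZFSet) ∈ (b : ZFSet)) : a = b := by
  refine Subtype.ext (ZFSet.ext fun w => ⟨fun hw => ?_, fun hw => ?_⟩)
  · exact (h ⟨w, hM.out.1 _ a.2 _ hw⟩).1 hw
  · exact (h ⟨w, hM.out.1 _ b.2 _ hw⟩).2 hw

theorem exists_unordered_pair (a b : ↥M) :
    ∃ z : ↥M, ∀ w : ↥M, (w : ZFSet) ∈ (z : ZFSet) ↔ w = a ∨ w = b := by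
  have := realize_axiom (M := M) (ψ := pairAx) (by simp)
  simp [pairAx, Fin.snoc] at this
  simpa [Subtype.ext_iff] using this a.1 a.2 b.1 b.2

theorem exists_sUnion (a : ↥M) :
    ∃ z : ↥M, ∀ w : ↥M, (w : ZFSet) ∈ (z : ZFSet) ↔
      ∃ u : ↥M, (u : ZFSet) ∈ (a : ZFSet) ∧ (w : ZFSet) ∈ (u : ZFSet) := by
  have := realize_axiom (M := M) (ψ := unionAx) (by simp)
  simp [unionAx, Fin.snoc] at this
  simpa using this a.1 a.2

theorem exists_powerset (a : ↥M) :
    ∃ z : ↥M, ∀ w : ↥M, (w : ZFSet) ∈ (z : ZFSet) ↔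
      ∀ u : ↥M, (u : ZFSet) ∈ (w : ZFSet) → (u : ZFSet) ∈ (a : ZFSet) := by
  have := realize_axiom (M := M) (ψ := powerAx) (by simp)
  simp [powerAx, Fin.snoc] at this
  simpa using this a.1 a.2

/-- The axiom of choice in a model, for families of disjoint nonempty sets. -/
theorem exists_selector (F : ↥M)
    (hne : ∀ X : ↥M, (X : ZFSet) ∈ (F : ZFSet) → ∃ w : ↥M, (w : ZFSet) ∈ (X : ZFSet))
    (hdisj : ∀ X Y : ↥M, (X : ZFSet) ∈ (F : ZFSet) → (Y : ZFSet) ∈ (F : ZFSet) →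
      ∀ w : ↥M, (w : ZFSet) ∈ (X : ZFSet) → (w : ZFSet) ∈ (Y : ZFSet) → X = Y) :
    ∃ K : ↥M, ∀ X : ↥M, (X : ZFSet) ∈ (F : ZFSet) →
      ∃ w : ↥M, (w : ZFSet) ∈ (X : ZFSet) ∧ (w : ZFSet) ∈ (K : ZFSet) ∧
        ∀ w' : ↥M, (w' : ZFSet) ∈ (X : ZFSet) → (w' : ZFSet) ∈ (K : ZFSet) → w' = w := by
  have := realize_axiom (M := M) (ψ := choiceAx) (by simp)
  simp [choiceAx, Fin.snoc] at this
  obtain ⟨K, hK, h⟩ := this F F.2 (fun X hX hXF => by simpa using hne ⟨X, hX⟩ hXF)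
    fun X hX Y hY hXF hYF hXY w hw hwX hwY =>
      hXY (congrArg Subtype.val (hdisj ⟨X, hX⟩ ⟨Y, hY⟩ hXF hYF ⟨w, hw⟩ hwX hwY))
  refine ⟨⟨K, hK⟩, fun X hX => ?_⟩
  obtain ⟨w, ⟨hwX, hwK⟩, hw, h⟩ := h X X.2 hX
  exact ⟨⟨w, hw⟩, hwX, hwK, fun w' h₁ h₂ => Subtype.ext (h w' w'.2 h₁ h₂)⟩

/-- The replacement axiom in a model. -/
theorem replacement (P : ↥M → ↥M → Prop)
    [h : ParamDef fun v : Fin 2 → ↥M => P (v 0) (v 1)] (x : ↥M)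
    (hP : ∀ w a b : ↥M, (w : ZFSet) ∈ (x : ZFSet) → P w a → P w b → a = b) :
    ∃ z : ↥M, ∀ a : ↥M, (a : ZFSet) ∈ (z : ZFSet) ↔
      ∃ w : ↥M, (w : ZFSet) ∈ (x : ZFSet) ∧ P w a := by
  obtain ⟨B, hB⟩ := collection P x
  have hP' : ParamDef fun v : Option (Fin 1) → ↥M => P (v none) (v (some 0)) :=
    CoDef.subst₂ h (fun v => v none) (fun v => v (some 0)) (fun v => v none) (fun v => v (some 0))
  obtain ⟨z, hz⟩ := separation (fun a => ∃ w : ↥M, (w : ZFSet) ∈ (x : ZFSet) ∧ P w a) B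
  refine ⟨z, fun a => (hz a).trans ⟨fun h => h.2, fun h => ⟨?_, h⟩⟩⟩
  obtain ⟨w, hw, ha⟩ := h
  obtain ⟨b, hb, hb'⟩ := hB w hw ⟨a, ha⟩
  rwa [hP w a b hw ha hb']


/-- The ordered pair of `a` and `b` belongs to `g`. -/
def PairMem (a b g : ↥M) : Prop := ZFSet.pair a b ∈ (g : ZFSet)

/-- `p` is the ordered pair of `a` and `b`. -/
def IsPair (p a b : ↥M) : Prop := (p : ZFSet) = ZFSet.pair a b

theorem eq_pair_of_forall {x y z : ↥M}
    (h : ∀ w : ↥M, (w : ZFSet) ∈ (z : ZFSet) ↔ w = x ∨ w = y) :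
    (z : ZFSet) = {(x : ZFSet), (y : ZFSet)} := by
  ext w
  rw [ZFSet.mem_pair]
  constructor
  · intro hw
    simpa [Subtype.ext_iff] using (h ⟨w, hM.out.1 _ z.2 _ hw⟩).1 hw
  · rintro (rfl | rfl)
    · exact (h x).2 (Or.inl rfl)
    · exact (h y).2 (Or.inr rfl)

theorem isPair_of_forall {s t p a b : ↥M}
    (hs : ∀ w : ↥M, (w : ZFSet) ∈ (s : ZFSet) ↔ w = a ∨ w = a)
    (ht : ∀ w : ↥M, (w : ZFSet) ∈ (t : ZFSet) ↔ w = a ∨ w = b)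
    (hp : ∀ w : ↥M, (w : ZFSet) ∈ (p : ZFSet) ↔ w = s ∨ w = t) : IsPair p a b := by
  rw [IsPair, eq_pair_of_forall hp, eq_pair_of_forall hs, eq_pair_of_forall ht, ZFSet.pair,
    ZFSet.pair_eq_singleton]

theorem exists_isPair (a b : ↥M) : ∃ p : ↥M, IsPair p a b := by
  obtain ⟨s, hs⟩ := exists_unordered_pair a a
  obtain ⟨t, ht⟩ := exists_unordered_pair a b
  obtain ⟨p, hp⟩ := exists_unordered_pair s t
  exact ⟨p, isPair_of_forall hs ht hp⟩

theorem isPair_iff (p a b : ↥M) : IsPair p a b ↔ ∃ s t : ↥M,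
    (∀ w : ↥M, (w : ZFSet) ∈ (s : ZFSet) ↔ w = a ∨ w = a) ∧
    (∀ w : ↥M, (w : ZFSet) ∈ (t : ZFSet) ↔ w = a ∨ w = b) ∧
    ∀ w : ↥M, (w : ZFSet) ∈ (p : ZFSet) ↔ w = s ∨ w = t := by
  refine ⟨fun h => ?_, fun ⟨s, t, hs, ht, hp⟩ => isPair_of_forall hs ht hp⟩
  obtain ⟨s, hs⟩ := exists_unordered_pair a a
  obtain ⟨t, ht⟩ := exists_unordered_pair a b
  obtain ⟨q, hq⟩ := exists_unordered_pair s t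
  obtain rfl : p = q := Subtype.ext (Eq.trans h (Eq.symm (isPair_of_forall hs ht hq)))
  exact ⟨s, t, hs, ht, hq⟩

theorem IsPair.inj {M : Set ZFSet.{u}} {p a b a' b' : ↥M} (h : IsPair p a b)
    (h' : IsPair p a' b') : a = a' ∧ b = b' := by
  rw [IsPair] at h h'
  rw [h', ZFSet.pair_inj] at h
  exact ⟨Subtype.ext h.1.symm, Subtype.ext h.2.symm⟩

theorem IsPair.unique {M : Set ZFSet.{u}} {p q a b : ↥M} (h : IsPair p a b)
    (h' : IsPair q a b) : p = q :=
  Subtype.ext (Eq.trans h (Eq.symm h'))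

theorem pairMem_iff (a b g : ↥M) :
    PairMem a b g ↔ ∃ p : ↥M, (p : ZFSet) ∈ (g : ZFSet) ∧ IsPair p a b := by
  constructor
  · intro h
    exact ⟨⟨_, hM.out.1 _ g.2 _ h⟩, h, rfl⟩
  · rintro ⟨p, hp, h⟩
    rwa [PairMem, ← h]

theorem PairMem.of_isPair {p a b g : ↥M} (hp : (p : ZFSet) ∈ (g : ZFSet)) (h : IsPair p a b) :
    PairMem a b g :=
  (pairMem_iff a b g).2 ⟨p, hp, h⟩

theorem pair_components_mem {a b : ZFSet} (g : ↥M) (h : ZFSet.pair a b ∈ (g : ZFSet)) :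
    a ∈ M ∧ b ∈ M := by
  have h₁ : ({a, b} : ZFSet) ∈ M :=
    hM.out.1 _ (hM.out.1 _ g.2 _ h) _ (by simp [ZFSet.pair])
  exact ⟨hM.out.1 _ h₁ _ (by simp), hM.out.1 _ h₁ _ (by simp)⟩

section Instances

variable {N : Set ZFSet.{u}} [hN : Fact (IsZFCModel N)] {C ι : Type*} (c : C → ↥M) (c' : C → ↥N)
  (s t r : (ι → ↥M) → ↥M) (s' t' r' : (ι → ↥N) → ↥N)
  [CoTerm c c' s s'] [CoTerm c c' t t'] [CoTerm c c' r r']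

instance coDef_isPair :
    CoDef c c' (fun v => IsPair (s v) (t v) (r v)) (fun v => IsPair (s' v) (t' v) (r' v)) := by
  refine CoDef.subst₃ ?_ s t r s' t' r'
  simp only [isPair_iff]
  infer_instance

instance coDef_pairMem :
    CoDef c c' (fun v => PairMem (s v) (t v) (r v)) (fun v => PairMem (s' v) (t' v) (r' v)) := by
  refine CoDef.subst₃ ?_ s t r s' t' r'
  simp only [pairMem_iff]
  infer_instance

end Instances

theorem exists_insert (F p : ↥M) :
    ∃ z : ↥M, ∀ w : ↥M, w.1 ∈ z.1 ↔ w.1 ∈ F.1 ∨ w = p := by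
  obtain ⟨s, hs⟩ := exists_unordered_pair p p
  obtain ⟨q, hq⟩ := exists_unordered_pair F s
  obtain ⟨z, hz⟩ := exists_sUnion q
  refine ⟨z, fun w => (hz w).trans ?_⟩
  simp only [hq]
  constructor
  · rintro ⟨u, rfl | rfl, hw⟩
    · exact Or.inl hw
    · simpa using Or.inr ((hs w).1 hw)
  · rintro (h | h)
    · exact ⟨F, Or.inl rfl, h⟩
    · exact ⟨s, Or.inr rfl, (hs w).2 (Or.inl h)⟩

/-- `T` is a transitive set. -/
abbrev IsTrans (T : ↥M) : Prop := ∀ x y : ↥M, x.1 ∈ T.1 → y.1 ∈ x.1 → y.1 ∈ T.1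

theorem exists_transitive_mem (x : ↥M) : ∃ T : ↥M, IsTrans T ∧ x.1 ∈ T.1 := by
  obtain ⟨x, hx⟩ := x
  induction x using ZFSet.inductionOn with
  | _ x ih =>
  obtain ⟨z, hz⟩ := collection (fun w T : ↥M => IsTrans T ∧ w.1 ∈ T.1) ⟨x, hx⟩
  obtain ⟨z', hz'⟩ := separation (fun T : ↥M => IsTrans T) z
  obtain ⟨U, hU⟩ := exists_sUnion z'
  obtain ⟨T, hT⟩ := exists_insert U ⟨x, hx⟩
  refine ⟨T, fun y w hy hw => ?_, (hT _).2 (Or.inr rfl)⟩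
  rcases (hT y).1 hy with hy | rfl
  · obtain ⟨u, hu, hyu⟩ := (hU y).1 hy
    exact (hT w).2 (Or.inl ((hU w).2 ⟨u, hu, ((hz' u).1 hu).2 y w hyu hw⟩))
  · obtain ⟨a, ha, ha', hwa⟩ := hz w hw (ih w hw w.2)
    exact (hT w).2 (Or.inl ((hU w).2 ⟨a, (hz' a).2 ⟨ha, ha'⟩, hwa⟩))

/-- `K` selects an element of every nonempty subset of `T`. -/
def IsChoice (T K : ↥M) : Prop :=
  ∀ A a : ↥M, (∀ t : ↥M, t.1 ∈ A.1 → t.1 ∈ T.1) →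
    a.1 ∈ A.1 → ∃ t : ↥M, t.1 ∈ A.1 ∧ PairMem A t K ∧
      ∀ t' : ↥M, t'.1 ∈ A.1 → PairMem A t' K → t' = t

/-- Every set of the model has a choice function in the model. -/
theorem exists_choice (T : ↥M) : ∃ K : ↥M, IsChoice T K := by
  obtain ⟨B, hB⟩ := exists_powerset T
  obtain ⟨B', hB'⟩ := separation (fun A : ↥M => ∃ a : ↥M, a.1 ∈ A.1) B
  obtain ⟨F, hF⟩ := replacement
    (fun A Q : ↥M => ∀ p : ↥M, p.1 ∈ Q.1 ↔ ∃ t : ↥M, t.1 ∈ A.1 ∧ IsPair p A t) B'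
    fun A Q Q' _ h h' => ext_of_transitive fun p => (h p).trans (h' p).symm
  obtain ⟨K, hK⟩ := exists_selector F
    (fun X hX => by
      obtain ⟨A, hA, hX⟩ := (hF X).1 hX
      obtain ⟨t, ht⟩ := ((hB' A).1 hA).2
      obtain ⟨p, hp⟩ := exists_isPair A t
      exact ⟨p, (hX p).2 ⟨t, ht, hp⟩⟩)
    (fun X Y hX hY w hwX hwY => by
      obtain ⟨A, hA, hX⟩ := (hF X).1 hX
      obtain ⟨A', hA', hY⟩ := (hF Y).1 hY
      obtain ⟨t, ht, hp⟩ := (hX w).1 hwX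
      obtain ⟨t', ht', hp'⟩ := (hY w).1 hwY
      obtain ⟨rfl, rfl⟩ := hp.inj hp'
      exact ext_of_transitive fun p => (hX p).trans (hY p).symm)
  refine ⟨K, fun A a hA ha => ?_⟩
  obtain ⟨X, hX⟩ := replacement (fun t p : ↥M => IsPair p A t) A
    fun t p p' _ h h' => h.unique h'
  obtain ⟨p, hp, hpK, huniq⟩ := hK X ((hF X).2 ⟨A, (hB' A).2 ⟨(hB A).2 hA, a, ha⟩, hX⟩)
  obtain ⟨t, ht, hpt⟩ := (hX p).1 hp
  refine ⟨t, ht, PairMem.of_isPair hpK hpt, fun t' ht' h => ?_⟩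
  obtain ⟨p', hp', hpt'⟩ := (pairMem_iff _ _ _).1 h
  obtain rfl := huniq p' ((hX p').2 ⟨t', ht', hpt'⟩) hp'
  exact (hpt'.inj hpt).2

/-- `α` is an ordinal. -/
abbrev IsOrd (α : ↥M) : Prop :=
  IsTrans α ∧ ∀ z y x : ↥M, z.1 ∈ α.1 → y.1 ∈ z.1 → x.1 ∈ y.1 → x.1 ∈ z.1

theorem isOrd_iff (α : ↥M) : IsOrd α ↔ α.1.IsOrdinal := by
  have tr : ∀ {a b : ZFSet}, b ∈ M → a ∈ b → a ∈ M := fun hb h => hM.out.1 _ hb _ h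
  constructor
  · rintro ⟨h₁, h₂⟩
    refine ⟨fun x hx y hy => ?_, fun {x y z} hx hy hz => ?_⟩
    · exact h₁ ⟨x, tr α.2 hx⟩ ⟨y, tr (tr α.2 hx) hy⟩ hx hy
    · exact h₂ ⟨z, tr α.2 hz⟩ ⟨y, tr (tr α.2 hz) hy⟩ ⟨x, tr (tr (tr α.2 hz) hy) hx⟩ hz hy hx
  · intro h
    exact ⟨fun x y hx hy => h.isTransitive _ hx hy, fun z y x hz hy hx => h.mem_trans' hx hy hz⟩

/-- `g` is a surjection from a subset of `l` onto a superset of the transitive set `T`. -/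
structure Enumerates (T l g : ↥M) : Prop where
  isTrans : IsTrans T
  surj : ∀ t : ↥M, t.1 ∈ T.1 → ∃ α : ↥M, α.1 ∈ l.1 ∧ PairMem α t g
  unique : ∀ α t t' : ↥M, PairMem α t g → PairMem α t' g → t = t'

section Zermelo

/-- `t` is the element chosen by `K` in the complement in `T` of the image of `α` under `g`. -/
abbrev IsNext (T K g α t : ↥M) : Prop :=
  (∀ β : ↥M, β.1 ∈ α.1 → ∃ s : ↥M, PairMem β s g) ∧
    ∃ A : ↥M, (∀ s : ↥M, s.1 ∈ A.1 ↔ s.1 ∈ T.1 ∧ ¬∃ β : ↥M, β.1 ∈ α.1 ∧ PairMem β s g) ∧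
      t.1 ∈ A.1 ∧ PairMem A t K

/-- `g` is an initial segment of the enumeration of `T` by means of the choice function `K`. -/
abbrev IsAttempt (T K g : ↥M) : Prop :=
  ∀ p : ↥M, p.1 ∈ g.1 → ∃ α t : ↥M, IsPair p α t ∧ IsOrd α ∧ IsNext T K g α t

variable {T K g h α β t s : ↥M}

theorem IsAttempt.of_pairMem (hg : IsAttempt T K g) (hp : PairMem α t g) :
    IsOrd α ∧ IsNext T K g α t := by
  obtain ⟨p, hp, hpt⟩ := (pairMem_iff _ _ _).1 hp
  obtain ⟨α', t', hpt', h⟩ := hg p hp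
  obtain ⟨rfl, rfl⟩ := hpt.inj hpt'
  exact h

theorem IsNext.congr {M : Set ZFSet.{u}} {T K g h α t : ↥M} (hn : IsNext T K g α t)
    (H : ∀ β : ↥M, β.1 ∈ α.1 → ∀ s, PairMem β s g ↔ PairMem β s h) : IsNext T K h α t := by
  obtain ⟨h₁, A, hA, h₂⟩ := hn
  refine ⟨fun β hβ => (h₁ β hβ).imp fun s => (H β hβ s).1, A, fun s => (hA s).trans ?_, h₂⟩
  exact and_congr_right fun _ => not_congr (exists_congr fun β =>
    and_congr_right fun hβ => H β hβ s)

theorem IsNext.unique (hK : IsChoice T K)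
    (h₁ : IsNext T K g α t) (h₂ : IsNext T K g α s) : t = s := by
  obtain ⟨-, A, hA, ht, htK⟩ := h₁
  obtain ⟨-, B, hB, hs, hsK⟩ := h₂
  obtain rfl : A = B := ext_of_transitive fun w => (hA w).trans (hB w).symm
  obtain ⟨r, -, -, hr⟩ := hK A t (fun t ht => ((hA t).1 ht).1) ht
  exact (hr t ht htK).trans (hr s hs hsK).symm

theorem IsAttempt.unique (hK : IsChoice T K)
    (hg : IsAttempt T K g) (hh : IsAttempt T K h) (ht : PairMem α t g) (hs : PairMem α s h) :
    t = s := by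
  obtain ⟨α, hα⟩ := α
  induction α using ZFSet.inductionOn generalizing t s with
  | _ α ih =>
  refine IsNext.unique hK ((hg.of_pairMem ht).2.congr fun β hβ r => ?_) (hh.of_pairMem hs).2
  constructor
  · intro hr
    obtain ⟨r', hr'⟩ := (hh.of_pairMem hs).2.1 β hβ
    rwa [ih β hβ β.2 hr hr']
  · intro hr
    obtain ⟨r', hr'⟩ := (hg.of_pairMem ht).2.1 β hβ
    rwa [← ih β hβ β.2 hr' hr]

theorem IsAttempt.inj (hK : IsChoice T K)
    (hg : IsAttempt T K g) (hh : IsAttempt T K h) (hα : PairMem α t g) (hβ : PairMem β t h) :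
    α = β := by
  have key : ∀ {g h α β : ↥M}, IsAttempt T K g → IsAttempt T K h → PairMem α t g →
      PairMem β t h → α.1 ∉ β.1 := by
    intro g h α β hg hh hα hβ hαβ
    obtain ⟨-, hn, A, hA, htA, -⟩ := hh.of_pairMem hβ
    obtain ⟨s, hs⟩ := hn α hαβ
    obtain rfl := hg.unique hK hh hα hs
    exact ((hA t).1 htA).2 ⟨α, hαβ, hs⟩
  rcases ((isOrd_iff α).1 (hg.of_pairMem hα).1).mem_trichotomous
    ((isOrd_iff β).1 (hh.of_pairMem hβ).1) with h₁ | h₁ | h₁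
  · exact absurd h₁ (key hg hh hα hβ)
  · exact Subtype.ext h₁
  · exact absurd h₁ (key hh hg hβ hα)

end Zermelo

theorem exists_enumerates {T : ↥M} (hT : IsTrans T) : ∃ l g : ↥M, IsOrd l ∧ Enumerates T l g := by
  obtain ⟨K, hK⟩ := exists_choice T
  obtain ⟨G, hG⟩ := replacement
    (fun t p : ↥M => ∃ α : ↥M, IsPair p α t ∧ ∃ g : ↥M, IsAttempt T K g ∧ p.1 ∈ g.1) T (by
      rintro t p p' - ⟨α, hp, g, hg, hpg⟩ ⟨β, hp', h, hh, hph⟩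
      obtain rfl := hg.inj hK hh (PairMem.of_isPair hpg hp) (PairMem.of_isPair hph hp')
      exact hp.unique hp')
  have hG' (α t : ↥M) : PairMem α t G ↔ ∃ g : ↥M, IsAttempt T K g ∧ PairMem α t g := by
    constructor
    · intro h
      obtain ⟨p, hp, hpt⟩ := (pairMem_iff _ _ _).1 h
      obtain ⟨s, hs, β, hps, g, hg, hpg⟩ := (hG p).1 hp
      exact ⟨g, hg, PairMem.of_isPair hpg hpt⟩
    · rintro ⟨g, hg, h⟩
      obtain ⟨-, -, A, hA, htA, -⟩ := hg.of_pairMem h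
      obtain ⟨p, hp, hpt⟩ := (pairMem_iff _ _ _).1 h
      exact PairMem.of_isPair ((hG p).2 ⟨t, ((hA t).1 htA).1, α, hpt, g, hg, hp⟩) hpt
  have hGatt : IsAttempt T K G := by
    intro p hp
    obtain ⟨t, ht, α, hpt, g, hg, hpg⟩ := (hG p).1 hp
    obtain ⟨hα, hn⟩ := hg.of_pairMem (PairMem.of_isPair hpg hpt)
    refine ⟨α, t, hpt, hα, hn.congr fun β hβ s => ⟨fun h => (hG' β s).2 ⟨g, hg, h⟩, fun h => ?_⟩⟩
    obtain ⟨g', hg', h⟩ := (hG' β s).1 h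
    obtain ⟨r, hr⟩ := hn.1 β hβ
    rwa [hg'.unique hK hg h hr]
  obtain ⟨l, hl⟩ := replacement (fun p α : ↥M => ∃ t : ↥M, IsPair p α t) G (by
    rintro p α β - ⟨t, ht⟩ ⟨s, hs⟩
    exact (ht.inj hs).1)
  have hl' (α : ↥M) : α.1 ∈ l.1 ↔ ∃ t, PairMem α t G := by
    simp only [hl, pairMem_iff]
    tauto
  have hlord : IsOrd l := by
    refine ⟨fun α β hα hβ => ?_, fun α β γ hα hβ hγ => ?_⟩
    · obtain ⟨t, ht⟩ := (hl' α).1 hα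
      exact (hl' β).2 ((hGatt.of_pairMem ht).2.1 β hβ)
    · obtain ⟨t, ht⟩ := (hl' α).1 hα
      exact (hGatt.of_pairMem ht).1.1 β γ hβ hγ
  refine ⟨l, G, hlord, hT, ?_, fun α t t' h h' => hGatt.unique hK hGatt h h'⟩
  by_contra! hne
  obtain ⟨t₀, ht₀, hne⟩ := hne
  obtain ⟨A, hA⟩ := separation (fun s : ↥M => ¬∃ β : ↥M, β.1 ∈ l.1 ∧ PairMem β s G) T
  obtain ⟨t, ht, htK, -⟩ := hK A t₀ (fun t ht => ((hA t).1 ht).1)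
    ((hA t₀).2 ⟨ht₀, fun ⟨β, hβ, h⟩ => hne β hβ h⟩)
  obtain ⟨p, hp⟩ := exists_isPair l t
  obtain ⟨G₁, hG₁⟩ := exists_insert G p
  have hagree : ∀ α : ↥M, α ≠ l → ∀ s, PairMem α s G ↔ PairMem α s G₁ := by
    intro α hα s
    rw [pairMem_iff, pairMem_iff]
    refine exists_congr fun q => and_congr_left fun hq => ?_
    rw [hG₁, or_iff_left]
    rintro rfl
    exact hα (hq.inj hp).1
  have hatt : IsAttempt T K G₁ := by
    intro q hq
    rcases (hG₁ q).1 hq with hq | rfl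
    · obtain ⟨α, s, hqs, hα, hn⟩ := hGatt q hq
      refine ⟨α, s, hqs, hα, hn.congr fun β hβ => hagree β ?_⟩
      rintro rfl
      exact ZFSet.mem_asymm hβ ((hl' α).2 ⟨s, PairMem.of_isPair hq hqs⟩)
    · refine ⟨l, t, hp, hlord, IsNext.congr (g := G) ⟨fun β hβ => (hl' β).1 hβ, A, hA, ht, htK⟩
        fun β hβ => hagree β ?_⟩
      rintro rfl
      exact ZFSet.mem_irrefl _ hβ
  exact ZFSet.mem_irrefl _ ((hl' l).2
    ⟨t, (hG' l t).2 ⟨G₁, hatt, PairMem.of_isPair ((hG₁ p).2 (Or.inr rfl)) hp⟩⟩)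

section Embedding

variable {N : Set ZFSet.{u}} [hN : Fact (IsZFCModel N)] (j : ↥M ↪ₑ[ZFLang] ↥N)

theorem map_mem_iff {M N : Set ZFSet.{u}} (j : ↥M ↪ₑ[ZFLang] ↥N) (a b : ↥M) :
    (j a).1 ∈ (j b).1 ↔ a.1 ∈ b.1 :=
  (CoDef.iff_map j (P := fun v : Fin 2 → ↥M => (v 0).1 ∈ (v 1).1)
    (Q := fun v => (v 0).1 ∈ (v 1).1) inferInstance ![a, b]).symm

theorem map_pairMem_iff (a b g : ↥M) : PairMem (j a) (j b) (j g) ↔ PairMem a b g :=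
  (CoDef.iff_map j (P := fun v : Fin 3 → ↥M => PairMem (v 0) (v 1) (v 2))
    (Q := fun v => PairMem (v 0) (v 1) (v 2)) inferInstance ![a, b, g]).symm

theorem exists_pairMem_of_map {a g : ↥M} {b : ↥N} (h : PairMem (j a) b (j g)) :
    ∃ b' : ↥M, PairMem a b' g :=
  (CoDef.iff_map j (P := fun v : Fin 2 → ↥M => ∃ b, PairMem (v 0) b (v 1))
    (Q := fun v => ∃ b, PairMem (v 0) b (v 1)) inferInstance ![a, g]).2 ⟨b, h⟩

theorem isOrdinal_map_iff (a : ↥M) : (j a).1.IsOrdinal ↔ a.1.IsOrdinal := by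
  rw [← isOrd_iff, ← isOrd_iff]
  exact (CoDef.iff_map j (P := fun v : Fin 1 → ↥M => IsOrd (v 0))
    (Q := fun v => IsOrd (v 0)) inferInstance ![a]).symm

theorem Enumerates.map {T l g : ↥M} (h : Enumerates T l g) : Enumerates (j T) (j l) (j g) := by
  have := (CoDef.iff_map j (P := fun v : Fin 3 → ↥M => IsTrans (v 0) ∧
      (∀ t : ↥M, t.1 ∈ (v 0).1 → ∃ α : ↥M, α.1 ∈ (v 1).1 ∧ PairMem α t (v 2)) ∧
        ∀ α t t' : ↥M, PairMem α t (v 2) → PairMem α t' (v 2) → t = t')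
    (Q := fun v : Fin 3 → ↥N => IsTrans (v 0) ∧
      (∀ t : ↥N, t.1 ∈ (v 0).1 → ∃ α : ↥N, α.1 ∈ (v 1).1 ∧ PairMem α t (v 2)) ∧
        ∀ α t t' : ↥N, PairMem α t (v 2) → PairMem α t' (v 2) → t = t')
    inferInstance ![T, l, g]).1 ⟨h.isTrans, h.surj, h.unique⟩
  exact ⟨this.1, this.2.1, this.2.2⟩

/-- An elementary embedding which fixes an ordinal and all its elements fixes every element of a
transitive set enumerated by that ordinal. -/
theorem Enumerates.fixed {T l g : ↥M} (h : Enumerates T l g) (hl : (j l).1 = l.1)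
    (hfix : ∀ β : ↥M, β.1 ∈ l.1 → (j β).1 = β.1) (y : ↥M) (hy : y.1 ∈ T.1) : (j y).1 = y.1 := by
  obtain ⟨y, hyM⟩ := y
  induction y using ZFSet.inductionOn with
  | _ y ih =>
  have hj := h.map j
  ext w
  constructor
  · intro hw
    obtain ⟨w, rfl⟩ : ∃ w' : ↥N, w'.1 = w := ⟨⟨w, hN.out.1 _ (j _).2 _ hw⟩, rfl⟩
    obtain ⟨β, hβ, hβw⟩ := hj.surj w (hj.isTrans _ w ((map_mem_iff j _ _).2 hy) hw)
    rw [hl] at hβ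
    obtain ⟨β', hβ'⟩ : ∃ β' : ↥M, β'.1 = β.1 := ⟨⟨β, hM.out.1 _ l.2 _ hβ⟩, rfl⟩
    obtain rfl : j β' = β := Subtype.ext ((hfix β' (hβ' ▸ hβ)).trans hβ')
    obtain ⟨t, ht⟩ := exists_pairMem_of_map j hβw
    obtain rfl : w = j t := hj.unique _ _ _ hβw ((map_pairMem_iff j _ _ _).2 ht)
    rw [map_mem_iff] at hw
    rw [ih t.1 hw t.2 (h.isTrans _ t hy hw)]
    exact hw
  · intro hw
    have hwM : w ∈ M := hM.out.1 _ hyM _ hw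
    have := (map_mem_iff j ⟨w, hwM⟩ ⟨y, hyM⟩).2 hw
    rwa [ih w hw hwM (h.isTrans _ ⟨w, hwM⟩ hy hw)] at this

/-- `f` relates sets to their collapses relative to `S`. -/
abbrev IsCollapsing (S f : ↥M) : Prop := ∀ t v : ↥M, PairMem t v f →
  (∀ u : ↥M, u.1 ∈ t.1 → u.1 ∈ S.1 → ∃ v' : ↥M, v'.1 ∈ v.1 ∧ PairMem u v' f) ∧
    ∀ v' : ↥M, v'.1 ∈ v.1 → ∃ u : ↥M, u.1 ∈ t.1 ∧ u.1 ∈ S.1 ∧ PairMem u v' f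

theorem IsCollapsing.eq_of_pairMem {T : ↥M} (hT : IsTrans T) {S f : ↥N}
    (hS : ImageSet M N j T S) (hf : IsCollapsing S f) (y : ↥M) (hy : y.1 ∈ T.1) {v : ↥N}
    (hv : PairMem (j y) v f) : v.1 = y.1 := by
  obtain ⟨y, hyM⟩ := y
  induction y using ZFSet.inductionOn generalizing v with
  | _ y ih =>
  obtain ⟨h₁, h₂⟩ := hf _ _ hv
  ext w
  constructor
  · intro hw
    obtain ⟨u, huy, huS, hu⟩ := h₂ ⟨w, hN.out.1 _ v.2 _ hw⟩ hw
    obtain ⟨y', hy', hu'⟩ := (hS u).1 huS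
    obtain rfl : j y' = u := Subtype.ext hu'
    rw [map_mem_iff] at huy
    have := ih y' huy y'.2 hy' hu
    dsimp only at this
    rw [this]
    exact huy
  · intro hw
    have hwT := hT _ ⟨w, hM.out.1 _ hyM _ hw⟩ hy hw
    obtain ⟨v', hv', h⟩ := h₁ (j ⟨w, hM.out.1 _ hyM _ hw⟩) ((map_mem_iff j _ _).2 hw)
      ((hS _).2 ⟨_, hwT, rfl⟩)
    have := ih w hw _ hwT h
    dsimp only at this
    rwa [← this]

theorem exists_isCollapsing {T : ↥M} (hT : IsTrans T) {S : ↥N} (hS : ImageSet M N j T S)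
    (y : ↥M) (hy : y.1 ∈ T.1) : ∃ f v : ↥N, IsCollapsing S f ∧ PairMem (j y) v f := by
  obtain ⟨y, hyM⟩ := y
  induction y using ZFSet.inductionOn with
  | _ y ih =>
  obtain ⟨z, hz⟩ := collection (fun u f : ↥N => IsCollapsing S f ∧ ∃ v, PairMem u v f) S
  obtain ⟨z', hz'⟩ := separation (fun f : ↥N => IsCollapsing S f) z
  obtain ⟨F, hF⟩ := exists_sUnion z'
  have hFp (t v : ↥N) : PairMem t v F ↔ ∃ f : ↥N, f.1 ∈ z'.1 ∧ PairMem t v f := by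
    simp only [pairMem_iff, hF]
    tauto
  have hFc : IsCollapsing S F := by
    intro t v h
    obtain ⟨f, hf, h⟩ := (hFp t v).1 h
    obtain ⟨h₁, h₂⟩ := ((hz' f).1 hf).2 t v h
    refine ⟨fun u hut huS => ?_, fun v' hv' => ?_⟩
    · obtain ⟨v', hv', h'⟩ := h₁ u hut huS
      exact ⟨v', hv', (hFp _ _).2 ⟨f, hf, h'⟩⟩
    · obtain ⟨u, hut, huS, h'⟩ := h₂ v' hv'
      exact ⟨u, hut, huS, (hFp _ _).2 ⟨f, hf, h'⟩⟩
  have hFd (u : ↥N) (hu : u.1 ∈ (j ⟨y, hyM⟩).1) (huS : u.1 ∈ S.1) : ∃ v, PairMem u v F := by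
    obtain ⟨y', hy', hu'⟩ := (hS u).1 huS
    obtain rfl : j y' = u := Subtype.ext hu'
    obtain ⟨f, v, hf, hv⟩ := ih y' ((map_mem_iff j _ _).1 hu) y'.2 hy'
    obtain ⟨f, hfz, hf, v, hv⟩ := hz (j y') huS ⟨f, hf, v, hv⟩
    exact ⟨v, (hFp _ _).2 ⟨f, (hz' f).2 ⟨hfz, hf⟩, hv⟩⟩
  obtain ⟨S', hS'⟩ := separation (fun u : ↥N => u.1 ∈ (j ⟨y, hyM⟩).1) S
  obtain ⟨Y, hY⟩ := replacement (fun u v : ↥N => PairMem u v F) S' (by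
    intro u v v' hu hv hv'
    obtain ⟨y', hy', hu'⟩ := (hS u).1 ((hS' u).1 hu).1
    obtain rfl : j y' = u := Subtype.ext hu'
    exact Subtype.ext ((hFc.eq_of_pairMem j hT hS y' hy' hv).trans
      (hFc.eq_of_pairMem j hT hS y' hy' hv').symm))
  obtain ⟨p, hp⟩ := exists_isPair (j ⟨y, hyM⟩) Y
  obtain ⟨F', hF'⟩ := exists_insert F p
  have hsub {t v : ↥N} (h : PairMem t v F) : PairMem t v F' := by
    obtain ⟨q, hq, h⟩ := (pairMem_iff _ _ _).1 h
    exact PairMem.of_isPair ((hF' q).2 (Or.inl hq)) h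
  refine ⟨F', Y, fun t v h => ?_, PairMem.of_isPair ((hF' p).2 (Or.inr rfl)) hp⟩
  obtain ⟨q, hq, hqt⟩ := (pairMem_iff _ _ _).1 h
  rcases (hF' q).1 hq with hq | rfl
  · obtain ⟨h₁, h₂⟩ := hFc t v (PairMem.of_isPair hq hqt)
    exact ⟨fun u hut huS => (h₁ u hut huS).imp fun _ => And.imp_right hsub,
      fun v' hv' => (h₂ v' hv').imp fun _ => And.imp_right (And.imp_right hsub)⟩
  · obtain ⟨rfl, rfl⟩ := hqt.inj hp
    refine ⟨fun u hut huS => ?_, fun v' hv' => ?_⟩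
    · obtain ⟨v', hv'⟩ := hFd u hut huS
      exact ⟨v', (hY v').2 ⟨u, (hS' u).2 ⟨huS, hut⟩, hv'⟩, hsub hv'⟩
    · obtain ⟨u, hu, h⟩ := (hY v').1 hv'
      exact ⟨u, ((hS' u).1 hu).2, ((hS' u).1 hu).1, hsub h⟩

theorem subset_of_amenable (h : Amenable M N j) : M ⊆ N := by
  intro x hx
  obtain ⟨T, hT, hxT⟩ := exists_transitive_mem (⟨x, hx⟩ : ↥M)
  obtain ⟨S, hSN, hS⟩ := h T T.2
  obtain ⟨f, v, hf, hv⟩ := exists_isCollapsing j hT (S := ⟨S, hSN⟩) hS _ hxT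
  have := hf.eq_of_pairMem j hT hS _ hxT hv
  dsimp only at this
  exact this ▸ v.2

end Embedding

theorem Enumerates.of_subset {N : Set ZFSet.{u}} (hMN : M ⊆ N) {T l g : ↥M}
    (h : Enumerates T l g) : Enumerates (⟨T, hMN T.2⟩ : ↥N) ⟨l, hMN l.2⟩ ⟨g, hMN g.2⟩ where
  isTrans x y hx hy := by
    have hxM := hM.out.1 _ T.2 _ hx
    exact h.isTrans ⟨x, hxM⟩ ⟨y, hM.out.1 _ hxM _ hy⟩ hx hy
  surj t ht := by
    obtain ⟨α, hα, hαt⟩ := h.surj ⟨t, hM.out.1 _ T.2 _ ht⟩ ht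
    exact ⟨⟨α, hMN α.2⟩, hα, hαt⟩
  unique α t t' ht ht' := by
    obtain ⟨hα, h₁⟩ := pair_components_mem g ht
    obtain ⟨-, h₂⟩ := pair_components_mem g ht'
    exact Subtype.ext (Subtype.mk.inj (h.unique ⟨α, hα⟩ ⟨t, h₁⟩ ⟨t', h₂⟩ ht ht'))

end TransitiveModel

end Model

/-! ### The direct limit -/

section Limit

open TransitiveModel Filter

universe u

/-- A commuting system of amenable elementary embeddings of transitive models of common height,
with critical points above the images of the ordinals `d n`. -/
structure IsAmenableSystem (d : ℕ → ZFSet.{u}) (M : ℕ → Set ZFSet.{u})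
    (j : ∀ m n, m ≤ n → (↥(M m) ↪ₑ[ZFLang] ↥(M n))) : Prop where
  ordinal : ∀ n, (d n).IsOrdinal ∧ d n ∈ d (n + 1)
  isModel : ∀ n, IsZFCModel (M n)
  height : ∀ n, ∀ x : ZFSet, x.IsOrdinal → (x ∈ M n ↔ ∃ m, x ∈ d m)
  map_id : ∀ n (x : ↥(M n)), j n n le_rfl x = x
  map_map : ∀ m n p (h1 : m ≤ n) (h2 : n ≤ p) (x : ↥(M m)),
    j m p (h1.trans h2) x = j n p h2 (j m n h1 x)
  crit : ∀ m n (h : m ≤ n) (κ : ZFSet),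
    IsCrit (M n) (M (n + 1)) (⇑(j n (n + 1) (Nat.le_succ n))) κ →
    ∀ hdn : d n ∈ M m, ((j m n h ⟨d n, hdn⟩ : ↥(M n)) : ZFSet) ∈ κ
  amenable : ∀ m n (h : m ≤ n), Amenable (M m) (M n) (⇑(j m n h))

namespace IsAmenableSystem

variable {d : ℕ → ZFSet.{u}} {M : ℕ → Set ZFSet.{u}}
  {j : ∀ m n, m ≤ n → (↥(M m) ↪ₑ[ZFLang] ↥(M n))} (S : IsAmenableSystem d M j)

theorem fact (S : IsAmenableSystem d M j) (n : ℕ) : Fact (IsZFCModel (M n)) := ⟨S.isModel n⟩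

theorem mem_of_le (S : IsAmenableSystem d M j) {n p : ℕ} (h : n ≤ p) {x : ZFSet} (hx : x ∈ d n) :
    x ∈ d p := by
  induction p, h using Nat.le_induction with
  | base => exact hx
  | succ p _ ih => exact (S.ordinal (p + 1)).1.mem_trans ih (S.ordinal p).2

theorem ordinal_mem (S : IsAmenableSystem d M j) (m n : ℕ) : d n ∈ M m :=
  (S.height m _ (S.ordinal n).1).2 ⟨n + 1, (S.ordinal n).2⟩

theorem subset (S : IsAmenableSystem d M j) {m n : ℕ} (h : m ≤ n) : M m ⊆ M n := by
  have := S.fact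
  exact subset_of_amenable (j m n h) (S.amenable m n h)

theorem fixed_of_mem_map (S : IsAmenableSystem d M j) {m p : ℕ} (h : m ≤ p) (β : ↥(M p))
    (hβ : β.1 ∈ (j m p h ⟨d p, S.ordinal_mem m p⟩).1) :
    (j p (p + 1) (Nat.le_succ p) β).1 = β.1 := by
  have := S.fact
  have hord : (j m p h ⟨d p, S.ordinal_mem m p⟩).1.IsOrdinal :=
    (isOrdinal_map_iff _ _).2 (S.ordinal p).1
  obtain ⟨β, hβM⟩ := β
  induction β using ZFSet.inductionOn with
  | _ β ih =>
  by_contra hne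
  exact ZFSet.mem_asymm hβ (S.crit m p h β ⟨hord.mem hβ, hβM, hne, fun γ hγ hγM =>
    ih γ hγ hγM (hord.mem_trans hγ hβ)⟩ (S.ordinal_mem m p))

theorem fixed_of_mem (S : IsAmenableSystem d M j) {n p : ℕ} (h : n ≤ p) (β : ↥(M n))
    (hβ : β.1 ∈ d n) :
    (j n p h β).1 = β.1 := by
  induction p, h using Nat.le_induction with
  | base => rw [S.map_id]
  | succ p h ih =>
    rw [S.map_map n p (p + 1) h (Nat.le_succ p), ← ih]
    refine S.fixed_of_mem_map le_rfl _ ?_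
    rw [S.map_id, ih]
    exact S.mem_of_le h hβ

theorem exists_enumerates (S : IsAmenableSystem d M j) (m : ℕ) (x : ↥(M m)) :
    ∃ n, m ≤ n ∧ ∃ T l g : ↥(M m), x.1 ∈ T.1 ∧ Enumerates T l g ∧ l.1 ∈ d n := by
  have := S.fact
  obtain ⟨T, hT, hx⟩ := exists_transitive_mem x
  obtain ⟨l, g, hl, h⟩ := TransitiveModel.exists_enumerates hT
  obtain ⟨n, hn⟩ := (S.height m l ((isOrd_iff l).1 hl)).1 l.2
  exact ⟨max m n, le_max_left _ _, T, l, g, hx, h, S.mem_of_le (le_max_right _ _) hn⟩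

theorem exists_stable (S : IsAmenableSystem d M j) (m : ℕ) (x : ↥(M m)) :
    ∃ n, ∃ h : m ≤ n, ∃ T : ↥(M m), IsTrans T ∧ x.1 ∈ T.1 ∧
      ∀ y : ↥(M m), y.1 ∈ T.1 → ∀ p (hp : n ≤ p), (j m p (h.trans hp) y).1 = (j m n h y).1 := by
  have := S.fact
  obtain ⟨n, hmn, T, l, g, hx, h, hl⟩ := S.exists_enumerates m x
  refine ⟨n, hmn, T, h.isTrans, hx, fun y hy p hp => ?_⟩
  induction p, hp using Nat.le_induction with
  | base => rfl
  | succ p hp ih =>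
    have hmp := hmn.trans hp
    have hl' : (j m p hmp l).1 ∈ (j m p hmp ⟨d p, S.ordinal_mem m p⟩).1 :=
      (map_mem_iff _ _ _).2 (S.mem_of_le hp hl)
    have hord : (j m p hmp ⟨d p, S.ordinal_mem m p⟩).1.IsOrdinal :=
      (isOrdinal_map_iff _ _).2 (S.ordinal p).1
    rw [S.map_map m p (p + 1) hmp (Nat.le_succ p), ← ih]
    exact (h.map (j m p hmp)).fixed _ (S.fixed_of_mem_map hmp _ hl')
      (fun β hβ => S.fixed_of_mem_map hmp β (hord.mem_trans hβ hl')) _ ((map_mem_iff _ _ _).2 hy)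

theorem exists_limit (S : IsAmenableSystem d M j) (m : ℕ) (x : ↥(M m)) :
    ∃ z : ↥(⋃ n, M n), ∀ᶠ p in atTop, ∀ h : m ≤ p, (j m p h x).1 = z := by
  obtain ⟨n, h, T, -, hx, hT⟩ := S.exists_stable m x
  refine ⟨⟨_, Set.mem_iUnion.2 ⟨n, (j m n h x).2⟩⟩, ?_⟩
  filter_upwards [eventually_ge_atTop n] with p hp _ using hT x hx p hp

/-- The direct limit map. -/
noncomputable def limit (S : IsAmenableSystem d M j) (m : ℕ) (x : ↥(M m)) : ↥(⋃ n, M n) :=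
  (S.exists_limit m x).choose

theorem eventually_eq_limit (S : IsAmenableSystem d M j) (m : ℕ) (x : ↥(M m)) :
    ∀ᶠ p in atTop, ∀ h : m ≤ p, (j m p h x).1 = S.limit m x :=
  (S.exists_limit m x).choose_spec

theorem limit_eq (S : IsAmenableSystem d M j) {m n : ℕ} {x : ↥(M m)} {z : ZFSet}
    (h : ∀ p (hm : m ≤ p), n ≤ p → (j m p hm x).1 = z) : (S.limit m x).1 = z := by
  obtain ⟨p, hp, hm, hn⟩ := ((S.eventually_eq_limit m x).and
    ((eventually_ge_atTop m).and (eventually_ge_atTop n))).exists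
  rw [← hp hm, h p hm hn]

theorem limit_map (S : IsAmenableSystem d M j) {m n : ℕ} (h : m ≤ n) (x : ↥(M m)) :
    S.limit n (j m n h x) = S.limit m x := by
  obtain ⟨p, hp, hp', hn⟩ := ((S.eventually_eq_limit m x).and
    ((S.eventually_eq_limit n (j m n h x)).and (eventually_ge_atTop n))).exists
  rw [Subtype.ext_iff, ← hp (h.trans hn), ← hp' hn, S.map_map m n p h hn]

theorem limit_injective (S : IsAmenableSystem d M j) (m : ℕ) : Function.Injective (S.limit m) := by
  intro x y hxy
  obtain ⟨p, hp, hp', hm⟩ := ((S.eventually_eq_limit m x).and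
    ((S.eventually_eq_limit m y).and (eventually_ge_atTop m))).exists
  exact (j m p hm).injective (Subtype.ext (by rw [hp hm, hp' hm, hxy]))

theorem limit_mem_iff (S : IsAmenableSystem d M j) (m : ℕ) (x y : ↥(M m)) :
    (S.limit m x).1 ∈ (S.limit m y).1 ↔ x.1 ∈ y.1 := by
  obtain ⟨p, hp, hp', hm⟩ := ((S.eventually_eq_limit m x).and
    ((S.eventually_eq_limit m y).and (eventually_ge_atTop m))).exists
  rw [← hp hm, ← hp' hm, map_mem_iff]

theorem exists_limit_eq (S : IsAmenableSystem d M j) (m : ℕ) (x : ↥(⋃ n, M n)) :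
    ∃ n, m ≤ n ∧ ∃ y : ↥(M n), S.limit n y = x := by
  have := S.fact
  obtain ⟨x, hx⟩ := x
  obtain ⟨q, hq⟩ := Set.mem_iUnion.1 hx
  obtain ⟨n, hmn, T, l, g, hxT, h, hl⟩ :=
    S.exists_enumerates (max m q) ⟨x, S.subset (le_max_right m q) hq⟩
  refine ⟨n, (le_max_left m q).trans hmn, ⟨x, S.subset ((le_max_right m q).trans hmn) hq⟩,
    Subtype.ext (S.limit_eq (n := n) fun p hp _ => ?_)⟩
  exact (h.of_subset (S.subset hmn)).fixed (j n p hp) (S.fixed_of_mem hp _ hl)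
    (fun β hβ => S.fixed_of_mem hp β ((S.ordinal n).1.mem_trans hβ hl)) ⟨x, _⟩ hxT

theorem limit_realize_term (S : IsAmenableSystem d M j) {α : Type} (m : ℕ) (t : ZFLang.Term α)
    (v : α → ↥(M m)) :
    t.realize (S.limit m ∘ v) = S.limit m (t.realize v) := by
  cases t with
  | var => rfl
  | func f => exact Empty.elim f

theorem relMap_limit (S : IsAmenableSystem d M j) (m : ℕ) {l : ℕ} (R : ZFLang.Relations l)
    (v : Fin l → ↥(M m)) :
    Structure.RelMap R (fun i => S.limit m (v i)) ↔ Structure.RelMap R v := by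
  match l, R with
  | 2, _ => exact S.limit_mem_iff m _ _
  | 0, R => exact Empty.elim R
  | 1, R => exact Empty.elim R
  | _ + 3, R => exact Empty.elim R

theorem realize_limit (S : IsAmenableSystem d M j) {α : Type} {l : ℕ}
    (φ : ZFLang.BoundedFormula α l) (m : ℕ)
    (v : α → ↥(M m)) (xs : Fin l → ↥(M m)) :
    φ.Realize (S.limit m ∘ v) (S.limit m ∘ xs) ↔ φ.Realize v xs := by
  induction φ generalizing m with
  | falsum => rfl
  | equal t₁ t₂ =>
    simp only [BoundedFormula.Realize, ← Sum.comp_elim, limit_realize_term]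
    exact (S.limit_injective m).eq_iff
  | rel R ts =>
    simp only [BoundedFormula.Realize, ← Sum.comp_elim, limit_realize_term]
    exact S.relMap_limit m R _
  | imp φ ψ ihφ ihψ => exact imp_congr (ihφ m v xs) (ihψ m v xs)
  | all φ ih =>
    constructor
    · intro h a
      rw [← ih, Fin.comp_snoc]
      exact h _
    · intro h a
      obtain ⟨n, hmn, y, rfl⟩ := S.exists_limit_eq m a
      have h' := ((j m n hmn).map_boundedFormula φ.all v xs).2 h y
      rw [← ih, Fin.comp_snoc] at h'
      rwa [← Function.comp_assoc, ← Function.comp_assoc,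
        show S.limit n ∘ j m n hmn = S.limit m from funext (S.limit_map hmn)] at h'

/-- The direct limit map, as an elementary embedding. -/
noncomputable def limitEmbedding (S : IsAmenableSystem d M j) (m : ℕ) :
    ↥(M m) ↪ₑ[ZFLang] ↥(⋃ n, M n) where
  toFun := S.limit m
  map_formula' n φ x := by
    rw [Formula.Realize, Formula.Realize, ← S.realize_limit φ m x default]
    exact Eq.to_iff (congrArg _ (Subsingleton.elim _ _))

theorem amenable_limit (S : IsAmenableSystem d M j) (m : ℕ) : Amenable (M m) (⋃ n, M n)
    (S.limit m) := by
  intro x hx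
  obtain ⟨n, h, T, hT, hxT, hstable⟩ := S.exists_stable m ⟨x, hx⟩
  obtain ⟨z, hz, hzx⟩ := S.amenable m n h x hx
  refine ⟨z, Set.mem_iUnion.2 ⟨n, hz⟩, fun w => (hzx w).trans ?_⟩
  refine exists_congr fun y => and_congr_right fun hy => ?_
  rw [S.limit_eq (n := n) fun p _ hn => hstable y (hT _ y hxT hy) p hn]

end IsAmenableSystem

end Limit

/-- under the hypotheses of the direct-limit lemma, if moreover each
`j_{m,n}` is amenable, then the direct limit maps `j_{n,ω}` are amenable and
`M_ω = ⋃_{n<ω} M_n`. -/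
theorem stmt6
    (d : ℕ → ZFSet) (hd : ∀ n, (d n).IsOrdinal ∧ d n ∈ d (n + 1))
    (M : ℕ → Set ZFSet) (hM : ∀ n, IsZFCModel (M n))
    (hht : ∀ n, ∀ x : ZFSet, x.IsOrdinal → (x ∈ M n ↔ ∃ m, x ∈ d m))
    (j : ∀ m n, m ≤ n → (↥(M m) ↪ₑ[ZFLang] ↥(M n)))
    (hid : ∀ n (x : ↥(M n)), j n n le_rfl x = x)
    (hcomm : ∀ m n p (h1 : m ≤ n) (h2 : n ≤ p) (x : ↥(M m)),
      j m p (h1.trans h2) x = j n p h2 (j m n h1 x))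
    (hcrit : ∀ m n (h : m ≤ n) (κ : ZFSet),
      IsCrit (M n) (M (n + 1)) (⇑(j n (n + 1) (Nat.le_succ n))) κ →
      ∀ hdn : d n ∈ M m, ((j m n h ⟨d n, hdn⟩ : ↥(M n)) : ZFSet) ∈ κ)
    (hamen : ∀ m n (h : m ≤ n), Amenable (M m) (M n) (⇑(j m n h))) :
    ∃ Mω : Set ZFSet, SetTransitive Mω ∧
      (∀ x : ZFSet, x.IsOrdinal → (x ∈ Mω ↔ ∃ m, x ∈ d m)) ∧
      Mω = ⋃ n, M n ∧
      ∃ k : ∀ n, ↥(M n) ↪ₑ[ZFLang] ↥Mω,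
        (∀ m n (h : m ≤ n) (x : ↥(M m)), k m x = k n (j m n h x)) ∧
        (∀ n, Amenable (M n) Mω (⇑(k n))) ∧
        (∀ x ∈ Mω, ∃ n, ∃ y : ↥(M n), ((k n y : ↥Mω) : ZFSet) = x) := by
  have S : IsAmenableSystem d M j := ⟨hd, hM, hht, hid, hcomm, hcrit, hamen⟩
  refine ⟨⋃ n, M n, fun x hx y hy => ?_, fun x hx => ?_, rfl, S.limitEmbedding,
    fun m n h x => (S.limit_map h x).symm, S.amenable_limit, fun x hx => ?_⟩
  · obtain ⟨n, hn⟩ := Set.mem_iUnion.1 hx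
    exact Set.mem_iUnion.2 ⟨n, (hM n).1 x hn y hy⟩
  · rw [Set.mem_iUnion]
    exact ⟨fun ⟨n, hn⟩ => (hht n x hx).1 hn, fun h => ⟨0, (hht 0 x hx).2 h⟩⟩
  · obtain ⟨n, -, y, hy⟩ := S.exists_limit_eq 0 ⟨x, hx⟩
    exact ⟨n, y, congrArg Subtype.val hy⟩
end

section
/- Let N be an ill-founded model of ZF minus Powerset with standard ω, let η be the order type of the well-founded ordinals of N, and for each N-ordinal α write α = i(α) + w(α) using Cantor normal form, where w(α) < η collects the terms ω^{α_k}·k with exponent below η and i(α) the remaining terms. Then for any ill-founded N-ordinal θ, the set { i(α) : α < θ, i(α) ≠ 0 }, ordered by N's ordinal order, is a dense linear order. -/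
open FirstOrder FirstOrder.Language

/-- The theory ZF minus Powerset (extensionality, pairing, union, infinity, foundation,
separation, collection). -/
def ZFminusP : ZFLang.Theory :=
  {extAx, pairAx, unionAx, infAx, foundAx} ∪
    (⋃ (k : ℕ), Set.range (@sepAx k)) ∪ (⋃ (k : ℕ), Set.range (@collAx k))

section IllFounded
variable {W : Type*} [ZFLang.Structure W]

/-- The membership relation of a model of set theory. -/
def E (x y : W) : Prop := Structure.RelMap memRel ![x, y]

/-- `x` is an ordinal of the model: transitive and linearly ordered by `E`. -/
def IsOrdW (x : W) : Prop :=
  (∀ y : W, E y x → ∀ z : W, E z y → E z x) ∧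
    ∀ y z : W, E y x → E z x → (E y z ∨ y = z ∨ E z y)

/-- The predecessors of `α` are (externally) well-founded. -/
def WfBelow (α : W) : Prop := {y : W | E y α}.WellFoundedOn (fun a b : W => E a b)

/-- `n` is an internal natural number. -/
def IsNatW (n : W) : Prop :=
  IsOrdW n ∧ ∀ m : W, (E m n ∨ m = n) →
    ((¬ ∃ p : W, E p m) ∨ ∃ p : W, E p m ∧ ∀ q : W, E q m ↔ (E q p ∨ q = p))

/-- The model has standard `ω`: internal naturals have finitely many predecessors. -/
def StdOmega (W : Type*) [ZFLang.Structure W] : Prop :=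
  ∀ n : W, IsNatW n → {y : W | E y n}.Finite

/-- `i` is the purely ill-founded part `i(α)` of the Cantor normal form decomposition
`α = i(α) + w(α)`: the interval `[i, α)` is externally well-founded (so `w(α)` is in the
well-founded part), while every proper final segment of `i` is ill-founded (so `i` has no
Cantor normal form term with exponent in the well-founded part). -/
def SplitsAt (α i : W) : Prop :=
  IsOrdW i ∧ (E i α ∨ i = α) ∧
    ({y : W | (E i y ∨ i = y) ∧ E y α}.WellFoundedOn (fun a b : W => E a b)) ∧
    ((¬ ∃ y : W, E y i) ∨
      ∀ β : W, E β i →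
        ¬ ({y : W | (E β y ∨ β = y) ∧ E y i}.WellFoundedOn (fun a b : W => E a b)))

end IllFounded


section Definability

/-- A notion of first-order definability with parameters on a type: a family of predicates on
assignments closed under the logical operations and substitution of variables and parameters. -/
class Definability (X : Type*) where
  Is : ((ℕ → X) → Prop) → Prop
  not' : ∀ {P}, Is P → Is (fun v => ¬ P v)
  and' : ∀ {P Q}, Is P → Is Q → Is (fun v => P v ∧ Q v)
  ex' : ∀ {P : (ℕ → X) → X → Prop}, Is (fun v => P (fun i => v (i + 1)) (v 0)) →
    Is (fun v => ∃ x, P v x)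
  eq' : Is (fun v => v 0 = v 1)
  subst' : ∀ {P}, Is P → ∀ g : ℕ → X ⊕ ℕ, Is (fun v => P (fun i => Sum.elim id v (g i)))

namespace Definability

variable {X : Type*}

/-- A term: a variable or a parameter. -/
def Tm (t : (ℕ → X) → X) : Prop := ∃ g : X ⊕ ℕ, t = fun v => Sum.elim id v g

theorem Tm.var (i : ℕ) : Tm (fun v : ℕ → X => v i) := ⟨Sum.inr i, rfl⟩
theorem Tm.const (c : X) : Tm (fun _ : ℕ → X => c) := ⟨Sum.inl c, rfl⟩

variable [Definability X] {P Q : (ℕ → X) → Prop}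

theorem imp (hP : Is P) (hQ : Is Q) : Is (fun v => P v → Q v) := by
  have := not' (and' hP (not' hQ))
  simpa using this

theorem or' (hP : Is P) (hQ : Is Q) : Is (fun v => P v ∨ Q v) := by
  have := not' (and' (not' hP) (not' hQ))
  simpa [← not_or] using this

theorem iff (hP : Is P) (hQ : Is Q) : Is (fun v => P v ↔ Q v) := by
  have := and' (imp hP hQ) (imp hQ hP)
  simpa [← iff_def] using this

theorem all {P : (ℕ → X) → X → Prop} (h : Is (fun v => P (fun i => v (i + 1)) (v 0))) :
    Is (fun v => ∀ x, P v x) := by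
  have := not' (ex' (P := fun v x => ¬ P v x) (not' h))
  simpa using this

/-- Definable unary predicates. -/
def Is1 (R : X → Prop) : Prop := Is (fun v => R (v 0))
/-- Definable binary predicates. -/
def Is2 (R : X → X → Prop) : Prop := Is (fun v => R (v 0) (v 1))
/-- Definable ternary predicates. -/
def Is3 (R : X → X → X → Prop) : Prop := Is (fun v => R (v 0) (v 1) (v 2))

theorem Is1.tm {R : X → Prop} (hR : Is1 R) {s : (ℕ → X) → X} (hs : Tm s) :
    Is (fun v => R (s v)) := by
  obtain ⟨g, rfl⟩ := hs
  exact subst' hR (fun _ => g)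

theorem Is2.tm {R : X → X → Prop} (hR : Is2 R) {s t : (ℕ → X) → X} (hs : Tm s) (ht : Tm t) :
    Is (fun v => R (s v) (t v)) := by
  obtain ⟨g, rfl⟩ := hs
  obtain ⟨h, rfl⟩ := ht
  exact subst' hR (fun i => match i with | 0 => g | _ => h)

theorem Is3.tm {R : X → X → X → Prop} (hR : Is3 R) {s t u : (ℕ → X) → X}
    (hs : Tm s) (ht : Tm t) (hu : Tm u) : Is (fun v => R (s v) (t v) (u v)) := by
  obtain ⟨g, rfl⟩ := hs
  obtain ⟨h, rfl⟩ := ht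
  obtain ⟨k, rfl⟩ := hu
  exact subst' hR (fun i => match i with | 0 => g | 1 => h | _ => k)

theorem eq {s t : (ℕ → X) → X} (hs : Tm s) (ht : Tm t) : Is (fun v => s v = t v) :=
  Is2.tm (R := fun a b => a = b) eq' hs ht

end Definability

end Definability

section Order

open Set Definability

variable {X : Type*} [LinearOrder X]

theorem isWF_of_forall_inter_Iio {S : Set X} (h : ∀ z ∈ S, (S ∩ Iio z).IsWF) : S.IsWF := by
  rw [isWF_iff_no_descending_seq]
  intro f hf hS
  have h0 := h (f 0) (hS 0)
  rw [isWF_iff_no_descending_seq] at h0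
  exact h0 (fun n => f (n + 1)) (fun m n hmn => hf (by omega))
    (fun n => ⟨hS _, hf (Nat.succ_pos n)⟩)

theorem exists_lt_not_isWF_Iio {x : X} (h : ¬ (Iio x).IsWF) : ∃ z < x, ¬ (Iio z).IsWF := by
  by_contra! hc
  exact h (isWF_of_forall_inter_Iio fun z hz => (hc z hz).mono inter_subset_right)

theorem isWF_Ico_of_forall {x y : X} (h : ∀ z, y < z → z < x → (Ico y z).IsWF) :
    (Ico y x).IsWF := by
  refine isWF_of_forall_inter_Iio fun z hz => ?_
  rcases hz.1.eq_or_lt with rfl | hyz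
  · refine (Set.finite_empty.isWF).mono ?_
    rintro w ⟨⟨h1, -⟩, h2⟩
    exact absurd h2 (not_lt.2 h1)
  · refine (h z hyz hz.2).mono ?_
    rintro w ⟨⟨h1, -⟩, h2⟩
    exact ⟨h1, h2⟩

/-- A linear order with a notion of definability in which definable nonempty sets have least
elements. -/
structure DefWO (X : Type*) [LinearOrder X] [Definability X] : Prop where
  lt : Is2 (fun a b : X => a < b)
  min : ∀ P : X → Prop, Is1 P → (∃ x, P x) → ∃ x, P x ∧ ∀ y < x, ¬ P y

variable [Definability X]

theorem DefWO.le (h : DefWO X) : Is2 (fun a b : X => a ≤ b) := by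
  have := not' (h.lt.tm (Tm.var 1) (Tm.var 0))
  simpa [Is2] using this

/-- A definable set with an element below `x` has either a largest element below `x` or a
limit point at most `x`. -/
theorem DefWO.exists_max_or_limit (h : DefWO X) {A : X → Prop} (hA : Is1 A) {x s₀ : X}
    (hs : A s₀) (hsx : s₀ < x) :
    (∃ s, A s ∧ s < x ∧ ∀ s', A s' → s' < x → s' ≤ s) ∨
      ∃ l ≤ x, s₀ < l ∧ ¬ (A l ∧ l < x) ∧ ∀ t < l, ∃ s, A s ∧ t < s ∧ s < l := by
  obtain ⟨l, hl, hmin⟩ := h.min (fun l => ∀ s, A s → s < x → s ≤ l)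
    (by
      unfold Is1
      repeat' with_reducible first
        | apply all | apply imp | apply hA.tm | apply h.lt.tm | apply h.le.tm
        | apply Tm.var | apply Tm.const)
    ⟨x, fun s _ hs => hs.le⟩
  by_cases hm : A l ∧ l < x
  · exact Or.inl ⟨l, hm.1, hm.2, hl⟩
  · right
    have hlx : l ≤ x := by
      by_contra! hc
      exact hmin x hc fun s _ hs => hs.le
    refine ⟨l, hlx, (hl s₀ hs hsx).lt_of_ne ?_, hm, fun t ht => ?_⟩
    · rintro rfl
      exact hm ⟨hs, hsx⟩
    · have := hmin t ht
      push Not at this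
      obtain ⟨s, h1, h2, h3⟩ := this
      refine ⟨s, h1, h3, (hl s h1 h2).lt_of_ne ?_⟩
      rintro rfl
      exact hm ⟨h1, h2⟩

/-- The order-theoretic version of internal natural numbers. -/
def IsNatO (n : X) : Prop := ∀ m ≤ n, (∀ p, ¬ p < m) ∨ ∃ p < m, ∀ q, q < m ↔ q ≤ p

/-- Recursive definition of functions by `v x = min {ξ | ∃ y, ∀ z < x, Q x y z → v z < ξ}`. -/
def HasRec (X : Type*) [LinearOrder X] [Definability X] : Prop :=
  ∀ Q : X → X → X → Prop, Is3 Q → ∃ v : X → X, Is2 (fun a b => v a = b) ∧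
    (∀ x, ∃ y, ∀ z < x, Q x y z → v z < v x) ∧
    ∀ x, ∀ ζ < v x, ∀ y, ∃ z < x, Q x y z ∧ ζ ≤ v z

theorem DefWO.finite_of_no_limit (h : DefWO X) (hrec : HasRec X)
    (hnat : ∀ n : X, IsNatO n → (Iio n).Finite) {S : X → Prop} (hS : Is1 S) {z : X}
    (hSz : ∀ s, S s → s ≤ z)
    (hlim : ∀ l ≤ z, ∀ s₀, S s₀ → s₀ < l → ¬ ∀ t < l, ∃ s, S s ∧ t < s ∧ s < l) :
    {s | S s}.Finite := by
  obtain ⟨c, hc, hc1, hc2⟩ := hrec (fun _ _ z => S z) (hS.tm (Tm.var 2))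
  have hmono : ∀ s t, S s → s < t → c s < c t := by
    intro s t hs hst
    obtain ⟨y, hy⟩ := hc1 t
    exact hy s hst hs
  have hN : ∀ x ≤ z, IsNatO (c x) := by
    by_contra! hcon
    obtain ⟨x, ⟨hxz, hx⟩, hmin⟩ := h.min (fun x => x ≤ z ∧ ¬ ∃ n, c x = n ∧ IsNatO n)
      (by
        unfold Is1 IsNatO
        repeat' with_reducible first
          | apply and' | apply not' | apply ex' | apply all | apply imp | apply iff | apply or'
          | apply hc.tm | apply h.lt.tm | apply h.le.tm | apply Tm.var | apply Tm.const)
      (by simpa using hcon)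
    apply hx
    refine ⟨_, rfl, ?_⟩
    by_cases hex : ∃ s₀, S s₀ ∧ s₀ < x
    · obtain ⟨s₀, hs₀, hs₀x⟩ := hex
      rcases h.exists_max_or_limit hS hs₀ hs₀x with ⟨s, hs, hsx, hmax⟩ | ⟨l, hl, hl0, -, hl'⟩
      · have hsN : IsNatO (c s) := by
          by_contra hn
          exact hmin s hsx ⟨hSz s hs, by simpa using hn⟩
        intro m hm
        rcases hm.eq_or_lt with rfl | hm
        · refine Or.inr ⟨c s, hmono s x hs hsx, fun q => ⟨fun hq => ?_, fun hq =>
            hq.trans_lt (hmono s x hs hsx)⟩⟩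
          obtain ⟨t, htx, ht, hqt⟩ := hc2 x q hq x
          rcases (hmax t ht htx).eq_or_lt with rfl | hts
          · exact hqt
          · exact hqt.trans (hmono t s ht hts).le
        · obtain ⟨t, htx, ht, hmt⟩ := hc2 x m hm x
          refine hsN m (hmt.trans ?_)
          rcases (hmax t ht htx).eq_or_lt with rfl | hts
          · exact le_rfl
          · exact (hmono t s ht hts).le
      · exact absurd hl' (hlim l (hl.trans hxz) s₀ hs₀ hl0)
    · intro m hm
      refine Or.inl fun p hp => hex ?_
      obtain ⟨t, htx, ht, -⟩ := hc2 x p (hp.trans_le hm) x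
      exact ⟨t, ht, htx⟩
  have hfin : (Iic (c z)).Finite := by
    have := (hnat _ (hN z le_rfl)).union (finite_singleton (c z))
    refine this.subset fun w hw => ?_
    rcases (show w ≤ c z from hw).eq_or_lt with h | h
    · exact Or.inr h
    · exact Or.inl h
  refine Finite.of_finite_image (f := c) (hfin.subset ?_) ?_
  · rintro _ ⟨s, hs, rfl⟩
    rcases (hSz s hs).eq_or_lt with rfl | hsz
    · exact le_rfl
    · exact (hmono s z hs hsz).le
  · intro s hs t ht hst
    rcases lt_trichotomy s t with hlt | heq | hlt
    · exact absurd hst (hmono s t hs hlt).ne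
    · exact heq
    · exact absurd hst (hmono t s ht hlt).ne'

/-- If the limit ranks of all points of an interval are bounded by a well-founded point, then the
interval is well-founded. -/
theorem DefWO.isWF_Ico_of_rank_lt (h : DefWO X) (hrec : HasRec X)
    (hnat : ∀ n : X, IsNatO n → (Iio n).Finite) {r : X → X} (hr : Is2 (fun a b => r a = b))
    (hr1 : ∀ w x, w < x → ∃ y < x, w ≤ y ∧ ∀ z, y < z → z < x → r z < r x)
    {ξ : X} (hξ : (Iio ξ).IsWF) :
    ∀ y x : X, (∀ z, y < z → z < x → r z < ξ) → (Ico y x).IsWF := by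
  have hlim : ∀ ρ w l, w < l → (∀ t < l, ∃ s, ρ ≤ r s ∧ t < s ∧ s < l) → ρ < r l := by
    intro ρ w l hwl H
    obtain ⟨y, hyl, -, hy⟩ := hr1 w l hwl
    obtain ⟨s, h1, h2, h3⟩ := H y hyl
    exact h1.trans_lt (hy s h2 h3)
  have hrle : Is2 (fun a b => r a ≤ r b) := by
    have : Is2 (fun a b => ∃ c, r a = c ∧ ∃ d, r b = d ∧ c ≤ d) := by
      unfold Is2
      repeat' with_reducible first
        | apply and' | apply ex' | apply hr.tm | apply h.le.tm | apply Tm.var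
    simpa using this
  have hwf : (Iic ξ).IsWF := by
    have := hξ.union (finite_singleton ξ).isWF
    exact this.mono fun w hw => (show w ≤ ξ from hw).lt_or_eq
  refine Set.WellFoundedOn.induction (P := fun ξ => ∀ y x : X,
    (∀ z, y < z → z < x → r z < ξ) → (Ico y x).IsWF) hwf (show ξ ∈ Iic ξ from le_rfl) ?_
  intro ξ hξ IH y x hyx
  refine isWF_Ico_of_forall fun z hyz hzx => ?_
  obtain ⟨S, hSd⟩ : ∃ S : X → Prop,
      ∀ s, S s ↔ y < s ∧ s ≤ z ∧ ∀ t, s < t → t ≤ z → r t ≤ r s := ⟨_, fun _ => Iff.rfl⟩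
  have hS : Is1 S := by
    unfold Is1
    simp only [hSd]
    repeat' with_reducible first
      | apply and' | apply all | apply imp | apply hrle.tm | apply h.lt.tm | apply h.le.tm
      | apply Tm.var | apply Tm.const
  have hSlim : ∀ l ≤ z, ∀ s₀, S s₀ → s₀ < l → ¬ ∀ t < l, ∃ s, S s ∧ t < s ∧ s < l := by
    intro l hlz s₀ hs₀ hs₀l H
    obtain ⟨ρ, ⟨s, hs, hsl, hsρ⟩, hmin⟩ := h.min (fun ρ => ∃ s, S s ∧ s < l ∧ r s = ρ)
      (by
        unfold Is1
        repeat' with_reducible first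
          | apply and' | apply ex' | apply hS.tm | apply h.lt.tm | apply hr.tm | apply Tm.var
          | apply Tm.const)
      ⟨_, s₀, hs₀, hs₀l, rfl⟩
    have h1 : ρ < r l := by
      refine hlim ρ s₀ l hs₀l fun t ht => ?_
      obtain ⟨s', h1, h2, h3⟩ := H t ht
      refine ⟨s', ?_, h2, h3⟩
      by_contra! hlt
      exact hmin _ hlt ⟨s', h1, h3, rfl⟩
    exact absurd (((hSd s).1 hs).2.2 l hsl hlz) (not_le.2 (hsρ ▸ h1))
  have hfin : {s | S s}.Finite :=
    h.finite_of_no_limit hrec hnat hS (fun s hs => ((hSd s).1 hs).2.1) hSlim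
  have key : ∀ s ∈ {s | S s}, (Ico y s).IsWF := by
    intro s hs
    refine Set.WellFoundedOn.induction (P := fun s => (Ico y s).IsWF) hfin.isWF hs ?_
    clear s hs
    intro s hs ih
    replace hs := (hSd s).1 hs
    have hrs : r s < ξ := hyx s hs.1 (hs.2.1.trans_lt hzx)
    have main : ∀ s', y ≤ s' → (∀ t, S t → t < s → t ≤ s') →
        (Ico s' s).IsWF := by
      intro s' hys' hmax
      refine IH (r s) (hrs.le.trans hξ) hrs s' s fun t h1 h2 => ?_
      by_contra! hc
      have hA : Is1 (fun u => s' < u ∧ r s ≤ r u) := by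
        unfold Is1
        repeat' with_reducible first
          | apply and' | apply hrle.tm | apply h.lt.tm | apply Tm.var | apply Tm.const
      rcases h.exists_max_or_limit hA (s₀ := t) ⟨h1, hc⟩ h2 with
        ⟨u, hu, hus, hu'⟩ | ⟨l, hls, htl, hlA, hl⟩
      · refine absurd (hmax u ((hSd u).2 ⟨hys'.trans_lt hu.1, hus.le.trans hs.2.1, fun w hw hwz => ?_⟩) hus)
          (not_le.2 hu.1)
        rcases lt_trichotomy w s with hws | rfl | hws
        · have : ¬ r s ≤ r w := fun hh => absurd (hu' w ⟨hu.1.trans hw, hh⟩ hws) (not_le.2 hw)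
          exact (not_le.1 this).le.trans hu.2
        · exact hu.2
        · exact (hs.2.2 w hws hwz).trans hu.2
      · have h3 : r s < r l := hlim _ t l htl fun w hw => by
          obtain ⟨u, hu, hu'⟩ := hl w hw
          exact ⟨u, hu.2, hu'⟩
        rcases hls.eq_or_lt with rfl | hls
        · exact lt_irrefl _ h3
        · exact hlA ⟨⟨h1.trans htl, h3.le⟩, hls⟩
    by_cases hex : ∃ s₀, S s₀ ∧ s₀ < s
    · obtain ⟨s₀, hs₀, hs₀s⟩ := hex
      rcases h.exists_max_or_limit hS hs₀ hs₀s with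
        ⟨s', hs', hs's, hmax⟩ | ⟨l, hls, hl0, -, hl⟩
      · refine ((ih s' hs' hs's).union
          (main s' ((hSd s').1 hs').1.le fun t ht hts => hmax t ht hts)).mono ?_
        intro w hw
        rcases lt_or_ge w s' with h1 | h1
        · exact Or.inl ⟨hw.1, h1⟩
        · exact Or.inr ⟨h1, hw.2⟩
      · exact absurd hl (hSlim l (hls.trans hs.2.1) s₀ hs₀ hl0)
    · exact main y le_rfl fun t ht hts => absurd ⟨t, ht, hts⟩ hex
  exact key z ((hSd z).2 ⟨hyz, le_rfl, fun t h1 h2 => absurd h1 (not_lt.2 h2)⟩)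

/-- Density of the points all of whose final segments are ill-founded. -/
theorem DefWO.exists_between (h : DefWO X) (hrec : HasRec X)
    (hnat : ∀ n : X, IsNatO n → (Iio n).Finite) {a b : X} (hab : a < b)
    (hb : ∀ β < b, ¬ (Ico β b).IsWF) :
    ∃ c, a < c ∧ c < b ∧ ∀ β < c, ¬ (Ico β c).IsWF := by
  obtain ⟨r, hr, hr1, hr2⟩ := hrec (fun x y z => y < x → y < z)
    (by
      unfold Is3
      repeat' with_reducible first
        | apply imp | apply h.lt.tm | apply Tm.var)
  have hr1' : ∀ w x, w < x → ∃ y < x, w ≤ y ∧ ∀ z, y < z → z < x → r z < r x := by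
    intro w x hwx
    obtain ⟨y, hy⟩ := hr1 x
    by_cases hyx : y < x
    · exact ⟨max w y, max_lt hwx hyx, le_max_left _ _, fun z h1 h2 =>
        hy z h2 fun _ => (le_max_right _ _).trans_lt h1⟩
    · exact ⟨w, hwx, le_rfl, fun z _ h2 => hy z h2 fun hh => absurd hh hyx⟩
  have hrb : ¬ (Iio (r b)).IsWF := by
    intro hwf
    obtain ⟨y, hyb, -, hy⟩ := hr1' a b hab
    exact hb y hyb (h.isWF_Ico_of_rank_lt hrec hnat hr hr1' hwf y b hy)
  have step : ∀ y z, y < z → ¬ (Iio (r z)).IsWF →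
      ∃ w, y < w ∧ w < z ∧ ¬ (Iio (r w)).IsWF := by
    intro y z hyz hz
    obtain ⟨ζ, hζ, hζ'⟩ := exists_lt_not_isWF_Iio hz
    obtain ⟨w, hwz, hyw, hw⟩ := hr2 z ζ hζ y
    exact ⟨w, hyw hyz, hwz, fun hh => hζ' (hh.mono (Iio_subset_Iio hw))⟩
  obtain ⟨c, hac, hcb, hc⟩ := step a b hab hrb
  refine ⟨c, hac, hcb, fun β hβ hwf => ?_⟩
  obtain ⟨w₀, h1, h2, h3⟩ := step β c hβ hc
  have hT : {w ∈ Ico β c | β < w ∧ ¬ (Iio (r w)).IsWF}.IsWF := hwf.mono (sep_subset _ _)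
  have hne : {w ∈ Ico β c | β < w ∧ ¬ (Iio (r w)).IsWF}.Nonempty := ⟨w₀, ⟨h1.le, h2⟩, h1, h3⟩
  obtain ⟨hm1, hm2, hm3⟩ := hT.min_mem hne
  obtain ⟨w, hw1, hw2, hw3⟩ := step β _ hm2 hm3
  exact hT.not_lt_min hne ⟨⟨hw1.le, hw2.trans hm1.2⟩, hw1, hw3⟩ hw2

end Order


section Model

open Definability

variable {W : Type*} [ZFLang.Structure W]

/-- First-order definability with parameters over a model of set theory. -/
instance definabilityW : Definability W where
  Is P := ∃ φ : ZFLang.Formula (W ⊕ ℕ), ∀ v : ℕ → W, φ.Realize (Sum.elim id v) ↔ P v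
  not' := by
    rintro P ⟨φ, hφ⟩
    exact ⟨φ.not, fun v => by simp [hφ]⟩
  and' := by
    rintro P Q ⟨φ, hφ⟩ ⟨ψ, hψ⟩
    exact ⟨φ ⊓ ψ, fun v => by simp [hφ, hψ]⟩
  ex' := by
    rintro P ⟨φ, hφ⟩
    refine ⟨(φ.relabel (fun
      | .inl w => .inl (.inl w)
      | .inr 0 => .inr ()
      | .inr (n + 1) => .inl (.inr n)) : ZFLang.Formula ((W ⊕ ℕ) ⊕ Unit)).iExs Unit,
      fun v => ?_⟩
    rw [Formula.realize_iExs]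
    have key : ∀ i : Unit → W, (φ.relabel (fun
      | .inl w => .inl (.inl w)
      | .inr 0 => .inr ()
      | .inr (n + 1) => .inl (.inr n)) : ZFLang.Formula ((W ⊕ ℕ) ⊕ Unit)).Realize
        (Sum.elim (Sum.elim id v) i) ↔ P v (i ()) := by
      intro i
      rw [Formula.realize_relabel]
      have := hφ (fun n => match n with | 0 => i () | n + 1 => v n)
      simp only at this
      rw [← this]
      refine iff_of_eq (congrArg _ ?_)
      funext j
      rcases j with w | _ | n <;> rfl
    simp only [key]
    exact ⟨fun ⟨i, hi⟩ => ⟨_, hi⟩, fun ⟨x, hx⟩ => ⟨fun _ => x, hx⟩⟩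
  eq' := ⟨Term.equal (Term.var (.inr 0)) (Term.var (.inr 1)), fun v => by
    simp [Formula.realize_equal]⟩
  subst' := by
    rintro P ⟨φ, hφ⟩ g
    refine ⟨φ.relabel (Sum.elim .inl g), fun v => ?_⟩
    refine Formula.realize_relabel.trans (Iff.trans ?_ (hφ _))
    refine iff_of_eq (congrArg _ ?_)
    funext j
    rcases j with w | n <;> rfl

theorem is2_E : Is2 (E : W → W → Prop) :=
  ⟨memRel.formula₂ (Term.var (.inr 0)) (Term.var (.inr 1)), fun v => by
    simp [Formula.realize_rel₂, E]⟩

/-- A definable predicate of `m` variables is given by a formula with finitely many parameters. -/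
theorem exists_boundedFormula {P : (ℕ → W) → Prop} (hP : Is P) (m : ℕ)
    (c : W) :
    ∃ (k : ℕ) (p : Fin k → W) (ψ : ZFLang.BoundedFormula Empty (k + m)), ∀ v : Fin m → W,
      ψ.Realize default (Fin.append p v) ↔ P (fun i => if h : i < m then v ⟨i, h⟩ else c) := by
  classical
  obtain ⟨φ, hφ⟩ := hP
  let e := φ.freeVarFinset.equivFin
  let p : Fin φ.freeVarFinset.card → W :=
    fun j => Sum.elim id (fun _ => c) (e.symm j : W ⊕ ℕ)
  let f : φ.freeVarFinset → Fin (φ.freeVarFinset.card + m) := fun x =>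
    match x with
    | ⟨.inl w, h⟩ => Fin.castAdd m (e ⟨.inl w, h⟩)
    | ⟨.inr i, h⟩ => if hi : i < m then Fin.natAdd _ ⟨i, hi⟩ else Fin.castAdd m (e ⟨.inr i, h⟩)
  refine ⟨φ.freeVarFinset.card, p,
    BoundedFormula.relabel (n := φ.freeVarFinset.card + m) (k := 0) Sum.inr
    (φ.restrictFreeVar f), fun v => ?_⟩
  have := Formula.realize_relabel_sumInr (M := W) (φ.restrictFreeVar f) (v := default)
    (x := Fin.append p v)
  refine this.trans ?_
  rw [← hφ]
  refine BoundedFormula.realize_restrictFreeVar _ ?_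
  rintro ⟨w | i, h⟩
  · simp [f, p]
  · by_cases hi : i < m
    · simpa [f, hi] using Fin.append_right p v ⟨i, hi⟩
    · simp [f, p, hi]

variable [hM : ZFminusP.Model W]

theorem model_realize {φ : ZFLang.Sentence} (h : φ ∈ ZFminusP) : W ⊨ φ :=
  hM.realize_of_mem φ h

theorem pair_W (x y : W) : ∃ p, ∀ q, E q p ↔ q = x ∨ q = y := by
  have := model_realize (W := W) (φ := pairAx) (by simp [ZFminusP])
  simp [pairAx, mem', _root_.eq', Sentence.Realize, Formula.Realize, Fin.snoc] at this
  exact this x y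

theorem found_W {x : W} (h : ∃ y, E y x) : ∃ y, E y x ∧ ∀ z, E z y → ¬ E z x := by
  have := model_realize (W := W) (φ := foundAx) (by simp [ZFminusP])
  simp [foundAx, mem', Sentence.Realize, Formula.Realize, Fin.snoc] at this
  obtain ⟨y, hy⟩ := h
  exact this x y hy

theorem sep_W {P : W → Prop} (hP : Is1 P) (a : W) : ∃ y, ∀ z, E z y ↔ E z a ∧ P z := by
  obtain ⟨k, p, ψ, hψ⟩ := exists_boundedFormula hP 1 a
  have h := model_realize (W := W) (φ := sepAx ψ)
    (Or.inl (Or.inr (Set.mem_iUnion.2 ⟨k, ψ, rfl⟩)))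
  rw [sepAx, Sentence.Realize, BoundedFormula.realize_alls] at h
  obtain ⟨y, hy⟩ := BoundedFormula.realize_ex.1 (BoundedFormula.realize_all.1 (h p) a)
  refine ⟨y, fun z => ?_⟩
  have hz := BoundedFormula.realize_all.1 hy z
  rw [BoundedFormula.realize_iff, BoundedFormula.realize_inf,
    BoundedFormula.realize_liftAt (by omega)] at hz
  have e1 : (Fin.snoc (Fin.snoc (Fin.snoc p a) y) z : Fin (k + 1 + 2) → W) ∘
      (fun i : Fin (k + 1) => if (i : ℕ) < k then Fin.castAdd 2 i else Fin.addNat i 2) =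
      Fin.append p (fun _ : Fin 1 => z) := by
    funext i
    refine Fin.addCases (fun i => ?_) (fun i => ?_) i
    · have h2 : (i : ℕ) < k + 2 := by omega
      rw [Fin.append_left]
      simp [Fin.snoc, Fin.castAdd, Fin.castLE, h2]
    · simp [Fin.snoc]
  have hz' : E z y ↔ E z a ∧ ψ.Realize default (Fin.append p (fun _ : Fin 1 => z)) := by
    rw [← e1]
    simpa [mem', Fin.snoc, E] using hz
  rw [hz', hψ]
  simp

theorem coll_W {P : W → W → Prop} (hP : Is2 P) (a : W) :
    ∃ b, ∀ x, E x a → (∃ y, P x y) → ∃ y, E y b ∧ P x y := by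
  obtain ⟨k, p, ψ, hψ⟩ := exists_boundedFormula hP 2 a
  have h := model_realize (W := W) (φ := collAx ψ)
    (Or.inr (Set.mem_iUnion.2 ⟨k, ψ, rfl⟩))
  rw [collAx, Sentence.Realize, BoundedFormula.realize_alls] at h
  obtain ⟨b, hb⟩ := BoundedFormula.realize_ex.1 (BoundedFormula.realize_all.1 (h p) a)
  refine ⟨b, fun x hx => ?_⟩
  have e1 : ∀ y, (Fin.snoc (Fin.snoc (Fin.snoc (Fin.snoc p a) b) x) y : Fin (k + 2 + 2) → W) ∘
      (fun i : Fin (k + 2) => if (i : ℕ) < k then Fin.castAdd 2 i else Fin.addNat i 2) =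
      Fin.append p ![x, y] := by
    intro y
    funext i
    refine Fin.addCases (fun i => ?_) (fun i => ?_) i
    · have h1 : (i : ℕ) < k + 1 := by omega
      have h2 : (i : ℕ) < k + 2 := by omega
      have h3 : (i : ℕ) < k + 3 := by omega
      rw [Fin.append_left]
      simp [Fin.snoc, Fin.castAdd, Fin.castLE, h1, h2, h3]
    · fin_cases i <;> simp [Fin.snoc]
  have h1 : ∀ y, (ψ.liftAt 2 k).Realize default
      (Fin.snoc (Fin.snoc (Fin.snoc (Fin.snoc p a) b) x) y : Fin (k + 2 + 2) → W) ↔ P x y := by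
    intro y
    rw [BoundedFormula.realize_liftAt (by omega), e1, hψ]
    simp
  have hz := BoundedFormula.realize_all.1 hb x
  rw [BoundedFormula.realize_imp, BoundedFormula.realize_imp, BoundedFormula.realize_ex,
    BoundedFormula.realize_ex] at hz
  rintro ⟨y, hy⟩
  obtain ⟨y', hy'⟩ := hz (by simpa [mem', Fin.snoc, E] using hx) ⟨y, (h1 y).2 hy⟩
  rw [BoundedFormula.realize_inf] at hy'
  refine ⟨y', ?_, (h1 y').1 hy'.2⟩
  simpa [mem', Fin.snoc, E] using hy'.1

end Model


section Ordinals

open Definability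

variable {W : Type*} [ZFLang.Structure W] [hM : ZFminusP.Model W] {θ : W}

theorem exists_E_minimal {P : W → Prop} (hP : Is1 P) (θ : W) (h : ∃ x, E x θ ∧ P x) :
    ∃ x, E x θ ∧ P x ∧ ∀ y, E y θ → E y x → ¬ P y := by
  obtain ⟨s, hs⟩ := sep_W hP θ
  obtain ⟨x, hx⟩ := h
  obtain ⟨y, hy, hy'⟩ := found_W ⟨x, (hs x).2 hx⟩
  exact ⟨y, ((hs y).1 hy).1, ((hs y).1 hy).2, fun z hz hzy hPz => hy' z hzy ((hs z).2 ⟨hz, hPz⟩)⟩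

theorem E_irrefl (x : W) : ¬ E x x := by
  obtain ⟨p, hp⟩ := pair_W x x
  obtain ⟨y, hy, hy'⟩ := found_W ⟨x, (hp x).2 (Or.inl rfl)⟩
  intro h
  obtain rfl : y = x := by simpa using (hp y).1 hy
  exact hy' y h hy

theorem IsOrdW.trans_E (hθ : IsOrdW θ) {x y z : W} (hz : E z θ) (hxy : E x y) (hyz : E y z) :
    E x z := by
  have hy := hθ.1 z hz y hyz
  have hx := hθ.1 y hy x hxy
  obtain ⟨m, -, hm, hmin⟩ := exists_E_minimal (P := fun w => w = x ∨ w = y ∨ w = z)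
    (by
      unfold Is1
      repeat' with_reducible first
        | apply or' | apply Definability.eq | apply Tm.var | apply Tm.const)
    θ ⟨x, hx, Or.inl rfl⟩
  rcases hθ.2 x z hx hz with h | rfl | h
  · exact h
  · rcases hm with rfl | rfl | rfl
    · exact absurd (Or.inr (Or.inl rfl)) (hmin y hy hyz)
    · exact absurd (Or.inl rfl) (hmin x hx hxy)
    · exact absurd (Or.inr (Or.inl rfl)) (hmin y hy hyz)
  · rcases hm with rfl | rfl | rfl
    · exact absurd (Or.inr (Or.inr rfl)) (hmin z hz h)
    · exact absurd (Or.inl rfl) (hmin x hx hxy)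
    · exact absurd (Or.inr (Or.inl rfl)) (hmin y hy hyz)

theorem IsOrdW.of_E (hθ : IsOrdW θ) {x : W} (hx : E x θ) : IsOrdW x :=
  ⟨fun _ hy _ hz => hθ.trans_E hx hz hy,
    fun y z hy hz => hθ.2 y z (hθ.1 x hx y hy) (hθ.1 x hx z hz)⟩

open Classical in
/-- The linear order on the elements of an internal ordinal. -/
noncomputable abbrev IsOrdW.linearOrder (hθ : IsOrdW θ) : LinearOrder {x : W // E x θ} where
  le x y := E x.1 y.1 ∨ x = y
  lt x y := E x.1 y.1
  le_refl x := Or.inr rfl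
  le_trans := by
    rintro x y z (h1 | rfl) (h2 | rfl)
    · exact Or.inl (hθ.trans_E z.2 h1 h2)
    · exact Or.inl h1
    · exact Or.inl h2
    · exact Or.inr rfl
  lt_iff_le_not_ge := by
    intro x y
    refine ⟨fun h => ⟨Or.inl h, ?_⟩, ?_⟩
    · rintro (h' | rfl)
      · exact E_irrefl x.1 (hθ.trans_E x.2 h h')
      · exact E_irrefl _ h
    · rintro ⟨h | rfl, h'⟩
      · exact h
      · exact absurd (Or.inr rfl) h'
  le_antisymm := by
    rintro x y (h1 | h1) (h2 | h2)
    · exact absurd (hθ.trans_E x.2 h1 h2) (E_irrefl _)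
    · exact h2.symm
    · exact h1
    · exact h1
  le_total := by
    intro x y
    rcases hθ.2 x.1 y.1 x.2 y.2 with h | h | h
    · exact Or.inl (Or.inl h)
    · exact Or.inl (Or.inr (Subtype.ext h))
    · exact Or.inr (Or.inl h)
  toDecidableLE := Classical.decRel _

/-- Definability on the set of elements of `θ`, inherited from the model. -/
abbrev definabilityBelow (θ : W) : Definability {x : W // E x θ} where
  Is P := ∃ P' : (ℕ → W) → Prop, Is P' ∧ ∀ v : ℕ → {x : W // E x θ}, P' (fun i => v i) ↔ P v
  not' := by
    rintro P ⟨P', h, h'⟩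
    exact ⟨_, not' h, fun v => not_congr (h' v)⟩
  and' := by
    rintro P Q ⟨P', h, h'⟩ ⟨Q', k, k'⟩
    exact ⟨_, and' h k, fun v => and_congr (h' v) (k' v)⟩
  ex' := by
    rintro P ⟨P', h, h'⟩
    let g : ℕ → (ℕ → W) → W → W := fun i v x => match i with | 0 => x | i + 1 => v i
    refine ⟨fun v => ∃ x, E x θ ∧ P' (fun i => g i v x), ?_, ?_⟩
    · apply ex'
      apply and' (is2_E.tm (Tm.var 0) (Tm.const θ))
      convert h using 3 with v
      funext i
      cases i <;> rfl
    · intro v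
      constructor
      · rintro ⟨x, hx, hP⟩
        refine ⟨⟨x, hx⟩, (h' (fun i => match i with | 0 => ⟨x, hx⟩ | i + 1 => v i)).1 ?_⟩
        convert hP using 2 with i
        cases i <;> rfl
      · rintro ⟨⟨x, hx⟩, hP⟩
        refine ⟨x, hx, ?_⟩
        have := (h' (fun i => match i with | 0 => ⟨x, hx⟩ | i + 1 => v i)).2 hP
        convert this using 2 with i
        cases i <;> rfl
  eq' := ⟨_, eq', fun v => Subtype.ext_iff.symm⟩
  subst' := by
    rintro P ⟨P', h, h'⟩ g
    refine ⟨_, subst' h (fun i => Sum.map Subtype.val id (g i)), fun v => ?_⟩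
    refine Iff.trans ?_ (h' _)
    refine iff_of_eq (congrArg _ ?_)
    funext i
    rcases g i with w | n <;> rfl

end Ordinals

section Recursion

open Definability

variable {W : Type*} [ZFLang.Structure W]

/-- `f`, as a set of unordered pairs, sends `z` to `u`, where `u` is at most `z`. -/
def FunRel (f z u : W) : Prop := (E u z ∨ u = z) ∧ ∃ p, E p f ∧ ∀ q, E q p ↔ q = u ∨ q = z

/-- `ξ` is an admissible bound for the value at `x`, given the values `f` below `x`. -/
def RecBound (Q : W → W → W → Prop) (θ f x ξ : W) : Prop :=
  ∃ y, E y θ ∧ ∀ z, E z x → Q x y z → ∀ u, FunRel f z u → E u ξ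

/-- `ξ` is the least admissible bound for the value at `x`, given the values `f` below `x`. -/
def RecVal (Q : W → W → W → Prop) (θ f x ξ : W) : Prop :=
  RecBound Q θ f x ξ ∧ ∀ ζ, E ζ ξ → ¬ RecBound Q θ f x ζ

/-- `f` satisfies the recursion below `x`. -/
def RecApprox (Q : W → W → W → Prop) (θ f x : W) : Prop :=
  ∀ z, E z x → (∃ u, FunRel f z u) ∧ ∀ u, FunRel f z u → RecVal Q θ f z u

/-- The class function defined by recursion. -/
def RecRel (Q : W → W → W → Prop) (θ x u : W) : Prop :=
  (E u x ∨ u = x) ∧ ∃ f, RecApprox Q θ f x ∧ RecVal Q θ f x u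

theorem is3_funRel : Is3 (FunRel : W → W → W → Prop) := by
  unfold Is3 FunRel
  repeat' with_reducible first
    | apply and' | apply ex' | apply all | apply iff | apply or' | apply is2_E.tm
    | apply Definability.eq | apply Tm.var

variable {Q : W → W → W → Prop} {θ : W}

theorem is3_recBound (hQ : Is3 Q) : Is3 (RecBound Q θ) := by
  unfold Is3 RecBound
  repeat' with_reducible first
    | apply and' | apply ex' | apply all | apply imp | apply is2_E.tm | apply hQ.tm
    | apply is3_funRel.tm | apply Tm.var | apply Tm.const

theorem is3_recVal (hQ : Is3 Q) : Is3 (RecVal Q θ) := by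
  unfold Is3 RecVal
  repeat' with_reducible first
    | apply and' | apply not' | apply all | apply imp | apply is2_E.tm
    | apply (is3_recBound hQ).tm | apply Tm.var

theorem is2_recApprox (hQ : Is3 Q) : Is2 (RecApprox Q θ) := by
  unfold Is2 RecApprox
  repeat' with_reducible first
    | apply and' | apply ex' | apply all | apply imp | apply is2_E.tm
    | apply (is3_recVal hQ).tm | apply is3_funRel.tm | apply Tm.var

theorem is2_recRel (hQ : Is3 Q) : Is2 (RecRel Q θ) := by
  unfold Is2 RecRel
  repeat' with_reducible first
    | apply and' | apply ex' | apply or' | apply is2_E.tm | apply Definability.eq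
    | apply (is3_recVal hQ).tm | apply (is2_recApprox hQ).tm | apply Tm.var

theorem recVal_congr {f g x u : W} (h : ∀ z, E z x → ∀ w, FunRel f z w ↔ FunRel g z w) :
    RecVal Q θ f x u ↔ RecVal Q θ g x u := by
  have : ∀ ξ, RecBound Q θ f x ξ ↔ RecBound Q θ g x ξ := by
    intro ξ
    unfold RecBound
    refine exists_congr fun y => and_congr_right fun _ => forall_congr' fun z =>
      forall_congr' fun hz => ?_
    simp only [h z hz]
  unfold RecVal
  simp only [this]

theorem IsOrdW.E_of_le (hθ : IsOrdW θ) {x u : W} (hx : E x θ) (h : E u x ∨ u = x) : E u θ := by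
  rcases h with h | rfl
  · exact hθ.1 x hx u h
  · exact hx

theorem recVal_unique (hθ : IsOrdW θ) {f x u v : W} (hu : E u θ) (hv : E v θ)
    (h1 : RecVal Q θ f x u) (h2 : RecVal Q θ f x v) : u = v := by
  rcases hθ.2 u v hu hv with h | h | h
  · exact absurd h1.1 (h2.2 u h)
  · exact h
  · exact absurd h2.1 (h1.2 v h)

variable [hM : ZFminusP.Model W]

theorem RecApprox.congr (hθ : IsOrdW θ) {f g x : W} (hx : E x θ)
    (hf : RecApprox Q θ f x) (hg : RecApprox Q θ g x) :
    ∀ z, E z x → ∀ w, FunRel f z w ↔ FunRel g z w := by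
  by_contra hcon
  obtain ⟨z, hzθ, ⟨hzx, hz⟩, hmin⟩ := exists_E_minimal
    (P := fun z => E z x ∧ ¬ ∀ w, FunRel f z w ↔ FunRel g z w)
    (by
      unfold Is1
      repeat' with_reducible first
        | apply and' | apply not' | apply all | apply iff | apply is2_E.tm
        | apply is3_funRel.tm | apply Tm.var | apply Tm.const) θ
    (by
      push Not at hcon
      obtain ⟨z, hz, w, hw⟩ := hcon
      exact ⟨z, hθ.1 x hx z hz, hz, fun h => by have := h w; tauto⟩)
  have hval : ∀ u, RecVal Q θ f z u ↔ RecVal Q θ g z u := fun u => recVal_congr fun z' hz' => by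
    by_contra hne
    exact hmin z' (hθ.1 z hzθ z' hz') hz' ⟨hθ.trans_E hx hz' hzx, hne⟩
  have aux : ∀ u v, FunRel f z u → FunRel g z v → u = v := fun u v hu hv =>
    recVal_unique hθ (hθ.E_of_le hzθ hu.1) (hθ.E_of_le hzθ hv.1) ((hf z hzx).2 u hu)
      ((hval v).2 ((hg z hzx).2 v hv))
  obtain ⟨u, hu⟩ := (hf z hzx).1
  obtain ⟨v, hv⟩ := (hg z hzx).1
  obtain rfl := aux u v hu hv
  exact hz fun w => ⟨fun h => (aux w u h hv) ▸ hv, fun h => (aux u w hu h) ▸ hu⟩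

theorem RecApprox.restrict (hθ : IsOrdW θ) {f x z : W} (hx : E x θ) (hz : E z x)
    (hf : RecApprox Q θ f x) : RecApprox Q θ f z :=
  fun w hw => hf w (hθ.trans_E hx hw hz)

theorem recRel_unique (hθ : IsOrdW θ) {x u v : W} (hx : E x θ)
    (h1 : RecRel Q θ x u) (h2 : RecRel Q θ x v) : u = v := by
  obtain ⟨h1, f, hf, hf'⟩ := h1
  obtain ⟨h2, g, hg, hg'⟩ := h2
  exact recVal_unique hθ (hθ.E_of_le hx h1) (hθ.E_of_le hx h2) hf'
    ((recVal_congr (hf.congr hθ hx hg)).2 hg')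

theorem RecApprox.funRel_iff (hθ : IsOrdW θ) {f x z w : W} (hx : E x θ) (hz : E z x)
    (hf : RecApprox Q θ f x) : FunRel f z w ↔ RecRel Q θ z w := by
  have key : ∀ w, FunRel f z w → RecRel Q θ z w := fun w h =>
    ⟨h.1, f, hf.restrict hθ hx hz, (hf z hz).2 w h⟩
  refine ⟨key w, fun h => ?_⟩
  obtain ⟨u, hu⟩ := (hf z hz).1
  rwa [recRel_unique hθ (hθ.1 x hx z hz) h (key u hu)]

theorem RecApprox.exists_recRel (hθ : IsOrdW θ) (hQ : Is3 Q) {f x : W} (hx : E x θ)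
    (hf : RecApprox Q θ f x) : ∃ u, RecRel Q θ x u := by
  have hbx : RecBound Q θ f x x := by
    refine ⟨x, hx, fun z hz _ u hu => ?_⟩
    rcases hu.1 with h | rfl
    · exact hθ.trans_E hx h hz
    · exact hz
  obtain ⟨u, huθ, hu, hmin⟩ := exists_E_minimal (P := fun u => RecBound Q θ f x u)
    ((is3_recBound hQ).tm (Tm.const f) (Tm.const x) (Tm.var 0)) θ ⟨x, hx, hbx⟩
  refine ⟨u, ?_, f, hf, hu, fun ζ hζ => hmin ζ (hθ.1 u huθ ζ hζ) hζ⟩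
  rcases hθ.2 u x huθ hx with h | h | h
  · exact Or.inl h
  · exact Or.inr h
  · exact absurd hbx (hmin x hx h)

theorem exists_recApprox (hθ : IsOrdW θ) (hQ : Is3 Q) : ∀ x, E x θ → ∃ f, RecApprox Q θ f x := by
  by_contra! hcon
  obtain ⟨x, hx, hxf, hmin⟩ := exists_E_minimal (P := fun x => ¬ ∃ f, RecApprox Q θ f x)
    (by
      unfold Is1
      repeat' with_reducible first
        | apply not' | apply ex' | apply (is2_recApprox hQ).tm | apply Tm.var) θ
    (by simpa using hcon)
  let Φ : W → W → Prop := fun z p => ∃ u, RecRel Q θ z u ∧ ∀ q, E q p ↔ q = u ∨ q = z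
  have hΦ : Is2 Φ := by
    unfold Is2
    repeat' with_reducible first
      | apply and' | apply ex' | apply all | apply iff | apply or' | apply is2_E.tm
      | apply Definability.eq | apply (is2_recRel hQ).tm | apply Tm.var
  obtain ⟨b, hb⟩ := coll_W hΦ x
  obtain ⟨f, hf⟩ := sep_W (P := fun p => ∃ z, E z x ∧ Φ z p)
    (by
      unfold Is1
      repeat' with_reducible first
        | apply hΦ.tm | apply and' | apply ex' | apply is2_E.tm | apply Tm.var
        | apply Tm.const) b
  have hex : ∀ z, E z x → ∃ u, FunRel f z u := by
    intro z hz
    have hzθ := hθ.1 x hx z hz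
    obtain ⟨g, hg⟩ := not_not.1 (hmin z hzθ hz)
    obtain ⟨u, hu⟩ := hg.exists_recRel hθ hQ hzθ
    obtain ⟨p, hp⟩ := pair_W u z
    obtain ⟨p', hp', hzp'⟩ := hb z hz ⟨p, u, hu, hp⟩
    obtain ⟨u', hu', hpu'⟩ := hzp'
    exact ⟨u', hu'.1, p', (hf p').2 ⟨hp', z, hz, u', hu', hpu'⟩, hpu'⟩
  have hrel : ∀ z, E z x → ∀ u, FunRel f z u → RecRel Q θ z u := by
    rintro z hz u ⟨huz, p, hpf, hp⟩
    obtain ⟨-, z', hz', u', hu', hp'⟩ := (hf p).1 hpf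
    have hzθ := hθ.1 x hx z hz
    have hzθ' := hθ.1 x hx z' hz'
    have e1 : z = u' ∨ z = z' := (hp' z).1 ((hp z).2 (Or.inr rfl))
    have e2 : z' = u ∨ z' = z := (hp z').1 ((hp' z').2 (Or.inr rfl))
    have e3 : u = u' ∨ u = z' := (hp' u).1 ((hp u).2 (Or.inl rfl))
    have e4 : u' = u ∨ u' = z := (hp u').1 ((hp' u').2 (Or.inl rfl))
    have hzz : z = z' := by
      rcases e1 with e1 | e1
      · rcases e2 with e2 | e2
        · subst e1 e2
          rcases huz with h1 | h1
          · rcases hu'.1 with h2 | h2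
            · exact absurd (hθ.trans_E hzθ h2 h1) (E_irrefl _)
            · exact h2
          · exact h1.symm
        · exact e2.symm
      · exact e1
    subst hzz
    have : u = u' := by
      rcases e3 with e3 | e3
      · exact e3
      · rcases e4 with e4 | e4
        · exact e4.symm
        · rw [e3, e4]
    rwa [this]
  have hrel' : ∀ z, E z x → ∀ u, FunRel f z u ↔ RecRel Q θ z u := by
    intro z hz u
    refine ⟨hrel z hz u, fun h => ?_⟩
    obtain ⟨w, hw⟩ := hex z hz
    rwa [recRel_unique hθ (hθ.1 x hx z hz) h (hrel z hz w hw)]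
  refine hxf ⟨f, fun z hz => ⟨hex z hz, fun u hu => ?_⟩⟩
  obtain ⟨-, g, hg, hgu⟩ := hrel z hz u hu
  have hzθ := hθ.1 x hx z hz
  refine (recVal_congr fun z' hz' w => ?_).2 hgu
  rw [hg.funRel_iff hθ hzθ hz', hrel' z' (hθ.trans_E hx hz' hz)]

theorem hasRec_below (hθ : IsOrdW θ) :
    letI := hθ.linearOrder
    letI := definabilityBelow θ
    HasRec {x : W // E x θ} := by
  let := hθ.linearOrder
  let := definabilityBelow θ
  intro Q hQ
  obtain ⟨Q', hQ', hQQ'⟩ := hQ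
  let R : W → W → W → Prop := fun x y z => Q' (fun i => match i with | 0 => x | 1 => y | _ => z)
  have hR : Is3 R := by
    have := subst' hQ' (fun i => match i with | 0 => .inr 0 | 1 => .inr 1 | _ => .inr 2)
    unfold Is3
    convert this using 3 with v
    funext i
    rcases i with _ | _ | i <;> rfl
  have hRQ : ∀ x y z : {x : W // E x θ}, R x y z ↔ Q x y z := by
    intro x y z
    refine Iff.trans ?_ (hQQ' (fun i => match i with | 0 => x | 1 => y | _ => z))
    refine iff_of_eq (congrArg Q' ?_)
    funext i
    rcases i with _ | _ | i <;> rfl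
  have hex : ∀ x : {x : W // E x θ}, ∃ u : {x : W // E x θ}, RecRel R θ x u := by
    intro x
    obtain ⟨f, hf⟩ := exists_recApprox hθ hR x x.2
    obtain ⟨u, hu⟩ := hf.exists_recRel hθ hR x.2
    exact ⟨⟨u, hθ.E_of_le x.2 hu.1⟩, hu⟩
  choose v hv using hex
  have hbound : ∀ f (x : {x : W // E x θ}), RecApprox R θ f x → ∀ ξ,
      RecBound R θ f x ξ ↔ ∃ y, ∀ z < x, Q x y z → E (v z).1 ξ := by
    intro f x hf ξ
    constructor
    · rintro ⟨y, hy, h⟩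
      exact ⟨⟨y, hy⟩, fun z hz hQz => h z hz ((hRQ _ ⟨y, hy⟩ _).2 hQz) _
        ((hf.funRel_iff hθ x.2 hz).2 (hv z))⟩
    · rintro ⟨y, h⟩
      refine ⟨y, y.2, fun z hz hRz u hu => ?_⟩
      have hzθ := hθ.1 x x.2 z hz
      rw [recRel_unique hθ hzθ ((hf.funRel_iff hθ x.2 hz).1 hu) (hv ⟨z, hzθ⟩)]
      exact h ⟨z, hzθ⟩ hz ((hRQ x y ⟨z, hzθ⟩).1 hRz)
  refine ⟨v, ⟨fun e => RecRel R θ (e 0) (e 1), is2_recRel hR, fun e => ⟨fun h => ?_, ?_⟩⟩,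
    fun x => ?_, fun x ζ hζ y => ?_⟩
  · exact Subtype.ext (recRel_unique hθ (e 0).2 (hv _) h)
  · intro h
    have := hv (e 0)
    rwa [h] at this
  · obtain ⟨-, f, hf, hfv⟩ := hv x
    exact (hbound f x hf _).1 hfv.1
  · obtain ⟨-, f, hf, hfv⟩ := hv x
    have := hfv.2 ζ hζ
    rw [hbound f x hf] at this
    push Not at this
    obtain ⟨z, hz, hQz, hle⟩ := this y
    exact ⟨z, hz, hQz, not_lt.1 hle⟩

end Recursion

section Density

open Set Definability

variable {W : Type*} [ZFLang.Structure W] [hM : ZFminusP.Model W] {θ : W}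

theorem defWO_below (hθ : IsOrdW θ) :
    letI := hθ.linearOrder
    letI := definabilityBelow θ
    DefWO {x : W // E x θ} := by
  let := hθ.linearOrder
  let := definabilityBelow θ
  refine ⟨⟨_, is2_E, fun v => Iff.rfl⟩, ?_⟩
  rintro P ⟨P', hP', hPP'⟩ ⟨x, hx⟩
  have key : ∀ x : {x : W // E x θ}, P' (fun _ => x) ↔ P x := fun x => hPP' (fun _ => x)
  obtain ⟨m, hmθ, hm, hmin⟩ := exists_E_minimal (P := fun x => P' (fun _ => x))
    (subst' hP' (fun _ => .inr 0)) θ ⟨x, x.2, (key x).2 hx⟩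
  exact ⟨⟨m, hmθ⟩, (key ⟨m, hmθ⟩).1 hm, fun y hy hPy => hmin y y.2 hy ((key y).2 hPy)⟩

theorem finite_Iio_below (hstd : StdOmega W) (hθ : IsOrdW θ) :
    letI := hθ.linearOrder
    ∀ n : {x : W // E x θ}, IsNatO n → (Iio n).Finite := by
  let := hθ.linearOrder
  intro n hn
  refine ((hstd n ⟨hθ.of_E n.2, fun m hm => ?_⟩).preimage Subtype.val_injective.injOn :)
  have hmθ := hθ.E_of_le n.2 hm
  rcases hn ⟨m, hmθ⟩ (hm.imp id Subtype.ext) with h | ⟨p, hp, h⟩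
  · exact Or.inl fun ⟨p, hp⟩ => h ⟨p, hθ.1 m hmθ p hp⟩ hp
  · refine Or.inr ⟨p, hp, fun q => ⟨fun hq => ?_, fun hq => ?_⟩⟩
    · exact ((h ⟨q, hθ.1 m hmθ q hq⟩).1 hq).imp id (congrArg Subtype.val)
    · exact (h ⟨q, hθ.E_of_le p.2 hq⟩).2 (hq.imp id Subtype.ext)

theorem isWF_Ico_below_iff (hθ : IsOrdW θ) :
    letI := hθ.linearOrder
    ∀ a b : {x : W // E x θ}, (Ico a b).IsWF ↔
      {y : W | (E a.1 y ∨ a.1 = y) ∧ E y b.1}.WellFoundedOn (fun x y : W => E x y) := by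
  let := hθ.linearOrder
  intro a b
  have : {y : W | (E a.1 y ∨ a.1 = y) ∧ E y b.1} = Subtype.val '' Ico a b := by
    ext y
    constructor
    · rintro ⟨h1, h2⟩
      exact ⟨⟨y, hθ.1 b b.2 y h2⟩, ⟨h1.imp id Subtype.ext, h2⟩, rfl⟩
    · rintro ⟨y, ⟨h1, h2⟩, rfl⟩
      exact ⟨h1.imp id (congrArg Subtype.val), h2⟩
  rw [this, wellFoundedOn_image]
  rfl

end Density

/-- in an ill-founded model `N` of ZF minus Powerset with standard `ω`,
for any ill-founded `N`-ordinal `θ`, the set `{ i(α) : α < θ, i(α) ≠ 0 }` of nonzero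
purely ill-founded parts, under `N`'s ordinal order, is a dense linear order. -/
theorem stmt15 (W : Type*) [ZFLang.Structure W] [ZFminusP.Model W]
    (hstd : StdOmega W)
    (θ : W) (hθ : IsOrdW θ) (hill : ¬ WfBelow θ) :
    ∀ D : Set W, D = {i | (∃ y : W, E y i) ∧ ∃ α : W, E α θ ∧ SplitsAt α i} →
      (∀ a ∈ D, ∀ b ∈ D, E a b ∨ a = b ∨ E b a) ∧
      (∀ a ∈ D, ∀ b ∈ D, E a b → ∃ c ∈ D, E a c ∧ E c b) := by
  rintro D rfl
  let := hθ.linearOrder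
  let := definabilityBelow θ
  have hmem : ∀ a, (∃ α : W, E α θ ∧ SplitsAt α a) → E a θ := fun a ⟨α, hα, h⟩ =>
    hθ.E_of_le hα h.2.1
  refine ⟨fun a ha b hb => hθ.2 a b (hmem a ha.2) (hmem b hb.2), ?_⟩
  rintro a ⟨⟨e, he⟩, ha⟩ b ⟨-, hb⟩ hab
  have haθ := hmem a ha
  have hbθ := hmem b hb
  obtain ⟨α, -, -, -, -, hbi⟩ := hb
  obtain ⟨c, hac, hcb, hc⟩ := (defWO_below hθ).exists_between (hasRec_below hθ)
    (finite_Iio_below hstd hθ) (a := ⟨a, haθ⟩) (b := ⟨b, hbθ⟩) hab fun β hβ => by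
      rw [isWF_Ico_below_iff hθ]
      exact hbi.resolve_left (fun h => h ⟨a, hab⟩) β hβ
  refine ⟨c, ⟨⟨a, hac⟩, c, c.2, hθ.of_E c.2, Or.inr rfl, ?_, Or.inr fun β hβ => ?_⟩, hac, hcb⟩
  · rw [← isWF_Ico_below_iff hθ c c, Set.Ico_self]
    exact Set.isWF_empty
  · rw [← isWF_Ico_below_iff hθ ⟨β, hθ.1 c c.2 β hβ⟩ c]
    exact hc _ hβ
end
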